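/- Fix integers l ≥ 1 and e ≥ 2, let s ∈ S_e, let (λ,s) be cylindric and not FLOTW with first pseudoperiod P(λ) of width α, and let i ∈ {0,…,e−1}. Suppose γ⁺ = (a, λ^c_a + 1, c) is the good addable i-node of (λ,s), where λ^c_a > α. Then the good addable i-node of (ψ(λ), ξ(s)) is Γ⁺ = (a, λ^c_a + 1, c+1) if 1 ≤ c < l, and Γ⁺ = (a, λ^c_a + 1, 1) if c = l. -/

import Mathlib

namespace FockCrystal

/-- A partition: `part a` is the `a`-th part, for `a ≥ 1`; `part 0` is a dummy value `0`. -/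
structure Partition where
  part : ℕ → ℕ
  part_zero : part 0 = 0
  antitone : ∀ a : ℕ, 1 ≤ a → part (a + 1) ≤ part a
  eventually_zero : ∃ N : ℕ, ∀ a : ℕ, N ≤ a → part a = 0

/-- A multipartition with `l + 1` components. -/
abbrev MultiPartition (l : ℕ) := Fin (l + 1) → Partition

/-- A node `(a, b, c)`: row `a ≥ 1`, column `b ≥ 1`, component `c`. -/
structure Node (l : ℕ) where
  row : ℕ
  col : ℕ
  comp : Fin (l + 1)

variable {l : ℕ}

def IsNode (Λ : MultiPartition l) (γ : Node l) : Prop :=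
  1 ≤ γ.row ∧ 1 ≤ γ.col ∧ γ.col ≤ (Λ γ.comp).part γ.row

/-- The content `b − a + s_c` of a node. -/
def content (s : Fin (l + 1) → ℤ) (γ : Node l) : ℤ :=
  (γ.col : ℤ) - (γ.row : ℤ) + s γ.comp

/-- `γ` is a removable node of `Λ`. -/
def Removable (Λ : MultiPartition l) (γ : Node l) : Prop :=
  1 ≤ γ.row ∧ 1 ≤ γ.col ∧ γ.col = (Λ γ.comp).part γ.row ∧
    (Λ γ.comp).part (γ.row + 1) < (Λ γ.comp).part γ.row

/-- `γ` is an addable node of `Λ`. -/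
def Addable (Λ : MultiPartition l) (γ : Node l) : Prop :=
  1 ≤ γ.row ∧ γ.col = (Λ γ.comp).part γ.row + 1 ∧
    (γ.row = 1 ∨ (Λ γ.comp).part γ.row < (Λ γ.comp).part (γ.row - 1))

/-- The strict order `≺_s` on nodes. -/
def NodeLt (s : Fin (l + 1) → ℤ) (γ γ' : Node l) : Prop :=
  content s γ < content s γ' ∨ (content s γ = content s γ' ∧ γ'.comp < γ.comp)

inductive Letter | A | R
  deriving DecidableEq

/-- The letter attached to a node is `A` iff the node is addable, `R` iff removable. -/
def LetterOk (Λ : MultiPartition l) (p : Node l × Letter) : Prop :=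
  (p.2 = Letter.A ↔ Addable Λ p.1) ∧ (p.2 = Letter.R ↔ Removable Λ p.1)

/-- `w` is the `i`-word of `(Λ, s)` for the residue-mod-`e` structure: the list of
addable/removable nodes of residue `i`, in increasing `≺_s`-order, with letters A/R. -/
def IsWordE (Λ : MultiPartition l) (s : Fin (l + 1) → ℤ) (e : ℕ) (i : ℤ)
    (w : List (Node l × Letter)) : Prop :=
  w.Pairwise (fun p q => NodeLt s p.1 q.1) ∧
  (∀ γ : Node l, (∃ x, (γ, x) ∈ w) ↔
      ((Addable Λ γ ∨ Removable Λ γ) ∧ content s γ % (e : ℤ) = i)) ∧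
  ∀ p ∈ w, LetterOk Λ p

/-- `w` is the `j`-word of `(Λ, s)` for the `e = ∞` structure: the list of
addable/removable nodes of content `j`, in increasing `≺_s`-order, with letters A/R. -/
def IsWordInf (Λ : MultiPartition l) (s : Fin (l + 1) → ℤ) (j : ℤ)
    (w : List (Node l × Letter)) : Prop :=
  w.Pairwise (fun p q => NodeLt s p.1 q.1) ∧
  (∀ γ : Node l, (∃ x, (γ, x) ∈ w) ↔
      ((Addable Λ γ ∨ Removable Λ γ) ∧ content s γ = j)) ∧
  ∀ p ∈ w, LetterOk Λ p

/-- Recursive cancellation of all factors `RA` in a word (of nodes with letters). -/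
def reduceW : List (Node l × Letter) → List (Node l × Letter)
  | [] => []
  | p :: ps =>
    match reduceW ps with
    | [] => [p]
    | q :: qs => if p.2 = Letter.R ∧ q.2 = Letter.A then qs else p :: q :: qs

/-- `γ` is the node encoded by the rightmost `A` of the reduced word of `w`. -/
def GoodAddableWord (w : List (Node l × Letter)) (γ : Node l) : Prop :=
  ∃ u v, reduceW w = u ++ (γ, Letter.A) :: v ∧ ∀ p ∈ v, p.2 = Letter.R

/-- `γ` is the node encoded by the leftmost `R` of the reduced word of `w`. -/
def GoodRemovableWord (w : List (Node l × Letter)) (γ : Node l) : Prop :=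
  ∃ u v, reduceW w = u ++ (γ, Letter.R) :: v ∧ ∀ p ∈ u, p.2 = Letter.A

/-- `γ` is the good addable `i`-node of `(Λ, s)` for the residue-mod-`e` structure. -/
def GoodAddable (Λ : MultiPartition l) (s : Fin (l + 1) → ℤ) (e : ℕ) (i : ℤ)
    (γ : Node l) : Prop :=
  ∃ w, IsWordE Λ s e i w ∧ GoodAddableWord w γ

/-- `γ` is the good removable `i`-node of `(Λ, s)` for the residue-mod-`e` structure. -/
def GoodRemovable (Λ : MultiPartition l) (s : Fin (l + 1) → ℤ) (e : ℕ) (i : ℤ)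
    (γ : Node l) : Prop :=
  ∃ w, IsWordE Λ s e i w ∧ GoodRemovableWord w γ

/-- `γ` is the good addable `j`-node of `(Λ, s)` for the `e = ∞` structure. -/
def GoodAddableInf (Λ : MultiPartition l) (s : Fin (l + 1) → ℤ) (j : ℤ)
    (γ : Node l) : Prop :=
  ∃ w, IsWordInf Λ s j w ∧ GoodAddableWord w γ

/-- `Λ'` is obtained from `Λ` by adding the node `γ`. -/
def AddNode (Λ Λ' : MultiPartition l) (γ : Node l) : Prop :=
  (Λ' γ.comp).part γ.row = (Λ γ.comp).part γ.row + 1 ∧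
  (∀ a : ℕ, a ≠ γ.row → (Λ' γ.comp).part a = (Λ γ.comp).part a) ∧
  ∀ c, c ≠ γ.comp → Λ' c = Λ c

/-- `s ∈ S_e`: `0 ≤ s_c − s_{c'} < e` whenever `c' < c`. -/
def InSe (e : ℕ) (s : Fin (l + 1) → ℤ) : Prop :=
  ∀ c' c : Fin (l + 1), c' < c → 0 ≤ s c - s c' ∧ s c - s c' < (e : ℤ)

/-- `s ∈ D_e`: `0 ≤ s_1 ≤ … ≤ s_l < e`. -/
def InDe (e : ℕ) (s : Fin (l + 1) → ℤ) : Prop :=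
  (∀ c, 0 ≤ s c ∧ s c < (e : ℤ)) ∧ Monotone s

/-- The rotation `c ↦ c + 1` of components. -/
def rho (l : ℕ) : Equiv.Perm (Fin (l + 1)) := finRotate (l + 1)

/-- The cyclage on multicharges: `ξ(s) = (s_l − e, s_1, …, s_{l−1})`. -/
def xiCharge (e : ℕ) (s : Fin (l + 1) → ℤ) : Fin (l + 1) → ℤ :=
  fun c => s ((rho l).symm c) - if c = 0 then (e : ℤ) else 0

/-- The cyclage on multipartitions: `ξ(λ) = (λ^l, λ^1, …, λ^{l−1})`. -/
def xiMP (Λ : MultiPartition l) : MultiPartition l := fun c => Λ ((rho l).symm c)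

/-- The corresponding bijection on nodes: `(a,b,c) ↦ (a,b,c+1)` cyclically. -/
def xiNode (γ : Node l) : Node l := ⟨γ.row, γ.col, rho l γ.comp⟩

/-- The component preceding `c` (cyclically). -/
def prevComp {l : ℕ} (c : Fin (l + 1)) : Fin (l + 1) := (rho l).symm c

/-- `(Λ, s)` is cylindric. -/
def Cylindric (e : ℕ) (s : Fin (l + 1) → ℤ) (Λ : MultiPartition l) : Prop :=
  (∀ c : Fin l, ∀ a : ℕ, 1 ≤ a →
      (Λ c.succ).part (a + (s c.succ - s c.castSucc).toNat) ≤ (Λ c.castSucc).part a) ∧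
  ∀ a : ℕ, 1 ≤ a →
      (Λ 0).part (a + ((e : ℤ) + s 0 - s (Fin.last l)).toNat) ≤ (Λ (Fin.last l)).part a

/-- `γ` is the rightmost node of a part of `Λ` of size `α`. -/
def RightmostAt (Λ : MultiPartition l) (α : ℕ) (γ : Node l) : Prop :=
  1 ≤ γ.row ∧ γ.col = α ∧ (Λ γ.comp).part γ.row = α

/-- The residues of the rightmost nodes of the parts of size `α` cover `{0,…,e−1}`. -/
def Covers (e : ℕ) (s : Fin (l + 1) → ℤ) (Λ : MultiPartition l) (α : ℕ) : Prop :=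
  ∀ r : ℤ, 0 ≤ r → r < (e : ℤ) →
    ∃ γ : Node l, RightmostAt Λ α γ ∧ content s γ % (e : ℤ) = r

/-- `(Λ, s)` is FLOTW. -/
def FLOTW (e : ℕ) (s : Fin (l + 1) → ℤ) (Λ : MultiPartition l) : Prop :=
  Cylindric e s Λ ∧ ∀ α : ℕ, 1 ≤ α → ¬ Covers e s Λ α

/-- `P 0, …, P (e−1)` is the first pseudoperiod of `(Λ, s)`, of width `α`. -/
def IsFirstPseudoperiod (e : ℕ) (s : Fin (l + 1) → ℤ) (Λ : MultiPartition l)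
    (α : ℕ) (P : ℕ → Node l) : Prop :=
  1 ≤ α ∧ Covers e s Λ α ∧ (∀ β : ℕ, α < β → ¬ Covers e s Λ β) ∧
  (∀ i, i < e → RightmostAt Λ α (P i)) ∧
  (∀ γ, RightmostAt Λ α γ → content s γ ≤ content s (P 0)) ∧
  (∀ γ, RightmostAt Λ α γ → content s γ = content s (P 0) → (P 0).comp ≤ γ.comp) ∧
  ∀ i : ℕ, i + 1 < e →
    content s (P (i + 1)) < content s (P i) ∧
    (∀ γ, RightmostAt Λ α γ → content s γ < content s (P i) →
        content s γ ≤ content s (P (i + 1))) ∧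
    ∀ γ, RightmostAt Λ α γ → content s γ = content s (P (i + 1)) →
        (P (i + 1)).comp ≤ γ.comp

/-- `γ` is one of the nodes of the pseudoperiod `P` (of length `e`). -/
def InPseudo (e : ℕ) (P : ℕ → Node l) (γ : Node l) : Prop := ∃ i, i < e ∧ P i = γ

/-- The number of parts of `π` equal to `v`. -/
noncomputable def countParts (π : Partition) (v : ℕ) : ℕ :=
  Nat.card {a : ℕ // 1 ≤ a ∧ π.part a = v}

/-- `N^{>α}_c`: the number of parts of `Λ^c` greater than `α`. -/
noncomputable def NgtA (Λ : MultiPartition l) (α : ℕ) (c : Fin (l + 1)) : ℕ :=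
  Nat.card {a : ℕ // 1 ≤ a ∧ α < (Λ c).part a}

/-- `N^α_c`: the number of parts of `Λ^c` (equal to `α`) whose rightmost node is in `P`. -/
noncomputable def NalP (e : ℕ) (P : ℕ → Node l) (c : Fin (l + 1)) : ℕ :=
  Nat.card {i : ℕ // i < e ∧ (P i).comp = c}

/-- The number of rows of component `c` above row `r` whose rightmost node is in `P`. -/
noncomputable def PAbove (e : ℕ) (P : ℕ → Node l) (c : Fin (l + 1)) (r : ℕ) : ℕ :=
  Nat.card {i : ℕ // i < e ∧ (P i).comp = c ∧ (P i).row < r}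

/-- `μ = ψ(Λ)`: for each component `C`, `μ^C` consists of the parts of `Λ^C` smaller
than `α`, the parts of `Λ^C` equal to `α` whose rightmost node is not in `P`, and the
parts of `Λ^{C−1}` (cyclically) greater than `α`; specified via part multiplicities. -/
def IsPsi (e : ℕ) (P : ℕ → Node l) (α : ℕ) (Λ μ : MultiPartition l) : Prop :=
  ∀ C : Fin (l + 1), ∀ v : ℕ, 1 ≤ v →
    countParts (μ C) v =
      if v < α then countParts (Λ C) v
      else if v = α then countParts (Λ C) α - NalP e P C
      else countParts (Λ (prevComp C)) v

/-- The canonical association between nodes of `Λ` (outside the rows of `P`) and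
nodes of `ψ(Λ)`: boxes of parts `> α` keep their row and move one component up
(cyclically), boxes of kept parts `≤ α` stay in their component, their row being
shifted by the number of rows removed above minus the number of rows inserted above. -/
def CanonAssoc (e : ℕ) (Λ : MultiPartition l) (α : ℕ) (P : ℕ → Node l)
    (γ Γ : Node l) : Prop :=
  Γ.col = γ.col ∧
  ( (α < (Λ γ.comp).part γ.row ∧ Γ.comp = rho l γ.comp ∧ Γ.row = γ.row)
  ∨ ((Λ γ.comp).part γ.row ≤ α ∧
      (∀ i, i < e → ¬ ((P i).comp = γ.comp ∧ (P i).row = γ.row)) ∧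
      Γ.comp = γ.comp ∧
      Γ.row + NgtA Λ α γ.comp + PAbove e P γ.comp γ.row
        = γ.row + NgtA Λ α (prevComp γ.comp)) )

/-- The entry of the `s`-symbol of `Λ` of size `p` in row `c` and column `k`
(`1 ≤ k ≤ p + s_c`): `b^c_a = λ^c_a − a + p + s_c` with `a = p + s_c − k + 1`. -/
def symbolEntry (s : Fin (l + 1) → ℤ) (Λ : MultiPartition l) (p : ℤ)
    (c : Fin (l + 1)) (k : ℕ) : ℤ :=
  ((Λ c).part (p + s c - (k : ℤ) + 1).toNat : ℤ) - (p + s c - (k : ℤ) + 1) + p + s c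

/-- `p` is an admissible size for the `s`-symbol of `Λ`:
`p ≥ 1 − s_c + h(λ^c)` for all `c`. -/
def SizeOK (s : Fin (l + 1) → ℤ) (Λ : MultiPartition l) (p : ℤ) : Prop :=
  ∀ c, 1 ≤ p + s c ∧ ∀ a : ℕ, p + s c ≤ (a : ℤ) → (Λ c).part a = 0

/-- The `s`-symbol of `Λ` of size `p` is semistandard: `s` is non-decreasing, the
entries in each column are non-decreasing (read from the row with the larger index
down to the row with the smaller one), and the entries in each row are increasing. -/
def SemistandardAt (s : Fin (l + 1) → ℤ) (Λ : MultiPartition l) (p : ℤ) : Prop :=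
  Monotone s ∧
  (∀ c c' : Fin (l + 1), c < c' → ∀ k : ℕ, 1 ≤ k → (k : ℤ) ≤ p + s c →
      symbolEntry s Λ p c' k ≤ symbolEntry s Λ p c k) ∧
  ∀ c, ∀ k : ℕ, 1 ≤ k → (k : ℤ) + 1 ≤ p + s c →
      symbolEntry s Λ p c k < symbolEntry s Λ p c (k + 1)

/-- The `s`-symbol of `Λ` is semistandard (for every admissible size). -/
def Semistandard (s : Fin (l + 1) → ℤ) (Λ : MultiPartition l) : Prop :=
  ∀ p : ℤ, SizeOK s Λ p → SemistandardAt s Λ p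

/-- The index of the column of the symbol of size `p` containing the entry
corresponding to the node `γ`. -/
def colOf (s : Fin (l + 1) → ℤ) (p : ℤ) (γ : Node l) : ℤ :=
  p + s γ.comp - (γ.row : ℤ) + 1

/-! ### Reduced words and partial sums -/

/-- The weight of a letter: `A` counts `1` and `R` counts `-1`. -/
def Letter.weight : Letter → ℤ
  | .A => 1
  | .R => -1

/-- The total weight of a word. -/
def wordSum : List (Node l × Letter) → ℤ
  | [] => 0
  | p :: ps => p.2.weight + wordSum ps

/-- The largest weight of a (possibly empty) initial segment of a word. -/
def maxInitialSum : List (Node l × Letter) → ℤ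
  | [] => 0
  | p :: ps => max 0 (p.2.weight + maxInitialSum ps)

/-- All suffixes of the word have nonnegative weight. -/
def SuffixNonneg : List (Node l × Letter) → Prop
  | [] => True
  | p :: ps => 0 ≤ wordSum (p :: ps) ∧ SuffixNonneg ps

lemma SuffixNonneg.wordSum_nonneg {w : List (Node l × Letter)} (h : SuffixNonneg w) :
    0 ≤ wordSum w := by
  cases w with
  | nil => simp [wordSum]
  | cons p ps => exact h.1

lemma reduceW_cons_A {p : Node l × Letter} (hp : p.2 = Letter.A) (ps : List (Node l × Letter)) :
    reduceW (p :: ps) = p :: reduceW ps := by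
  rw [reduceW]
  split <;> simp_all

lemma reduceW_cons_cancel {p q : Node l × Letter} {ps qs : List (Node l × Letter)}
    (hp : p.2 = Letter.R) (hps : reduceW ps = q :: qs) (hq : q.2 = Letter.A) :
    reduceW (p :: ps) = qs := by
  rw [reduceW, hps]
  simp [hp, hq]

lemma reduceW_cons_R {p : Node l × Letter} {ps : List (Node l × Letter)}
    (h : ∀ q ∈ reduceW ps, q.2 = Letter.R) : reduceW (p :: ps) = p :: reduceW ps := by
  rw [reduceW]
  split
  · simp_all
  · simp_all

/-- In a reduced word every `A` precedes every `R`. -/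
lemma reduceW_pairwise (w : List (Node l × Letter)) :
    (reduceW w).Pairwise (fun p q => p.2 = Letter.R → q.2 = Letter.R) := by
  induction w with
  | nil => simp [reduceW]
  | cons p ps ih =>
    cases hp : p.2 with
    | A => simp [reduceW_cons_A hp, ih, hp]
    | R =>
      by_cases h : ∀ q ∈ reduceW ps, q.2 = Letter.R
      · rw [reduceW_cons_R h]
        exact List.pairwise_cons.2 ⟨fun q hq _ => h q hq, ih⟩
      · cases hps : reduceW ps with
        | nil => simp [hps] at h
        | cons q qs =>
          rw [hps, List.pairwise_cons] at ih
          cases hq : q.2 with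
          | A => rw [reduceW_cons_cancel hp hps hq]; exact ih.2
          | R =>
            refine absurd ?_ h
            rw [hps]
            intro q' hq'
            rcases List.mem_cons.1 hq' with rfl | hq'
            · exact hq
            · exact ih.1 q' hq' hq

lemma reduceW_R_cases {p : Node l × Letter} (hp : p.2 = Letter.R) (ps : List (Node l × Letter)) :
    ((∀ q ∈ reduceW ps, q.2 = Letter.R) ∧ reduceW (p :: ps) = p :: reduceW ps) ∨
      ∃ q qs, q.2 = Letter.A ∧ reduceW ps = q :: qs ∧ reduceW (p :: ps) = qs := by
  by_cases h : ∀ q ∈ reduceW ps, q.2 = Letter.R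
  · exact Or.inl ⟨h, reduceW_cons_R h⟩
  · right
    have hpw := reduceW_pairwise ps
    cases hps : reduceW ps with
    | nil => simp [hps] at h
    | cons q qs =>
      rw [hps, List.pairwise_cons] at hpw
      cases hq : q.2 with
      | A => exact ⟨q, qs, hq, rfl, reduceW_cons_cancel hp hps hq⟩
      | R =>
        refine absurd ?_ h
        rw [hps]
        intro q' hq'
        rcases List.mem_cons.1 hq' with rfl | hq'
        · exact hq
        · exact hpw.1 q' hq' hq

lemma countP_A_eq_zero_iff {w : List (Node l × Letter)} :
    w.countP (fun p => p.2 = Letter.A) = 0 ↔ ∀ p ∈ w, p.2 = Letter.R := by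
  rw [List.countP_eq_zero]
  refine forall₂_congr fun p _ => ?_
  cases p.2 <;> simp

/-- The number of letters `A` of the reduced word is the largest weight of an initial segment. -/
lemma maxInitialSum_eq_countP (w : List (Node l × Letter)) :
    maxInitialSum w = ((reduceW w).countP (fun p => p.2 = Letter.A) : ℕ) := by
  induction w with
  | nil => simp [maxInitialSum, reduceW]
  | cons p ps ih =>
    cases hp : p.2 with
    | A =>
      rw [reduceW_cons_A hp, maxInitialSum, ih, hp, List.countP_cons_of_pos (by simp [hp])]
      simp only [Letter.weight]
      push_cast
      omega
    | R =>
      rcases reduceW_R_cases hp ps with ⟨h, h'⟩ | ⟨q, qs, hq, h, h'⟩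
      · rw [h', maxInitialSum, ih, List.countP_cons_of_neg (by simp [hp]),
          countP_A_eq_zero_iff.2 h, hp]
        simp [Letter.weight]
      · rw [h', maxInitialSum, ih, h, List.countP_cons_of_pos (by simp [hq]), hp]
        simp only [Letter.weight]
        push_cast
        omega

lemma maxInitialSum_append_cons {u v : List (Node l × Letter)} {γ : Node l}
    (hv : maxInitialSum v = 0) (hu : SuffixNonneg u) :
    maxInitialSum (u ++ (γ, Letter.A) :: v) = wordSum u + 1 := by
  induction u with
  | nil => simp [maxInitialSum, wordSum, hv, Letter.weight]
  | cons p ps ih =>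
    have h := hu.1
    rw [wordSum] at h ⊢
    rw [List.cons_append, maxInitialSum, ih hu.2]
    omega

/-- The good addable node of a word is the `A` whose left factor has only suffixes of
nonnegative weight and whose right factor has only initial segments of nonpositive weight. -/
lemma goodAddableWord_iff {w : List (Node l × Letter)} {γ : Node l} :
    GoodAddableWord w γ ↔
      ∃ u v, w = u ++ (γ, Letter.A) :: v ∧ maxInitialSum v = 0 ∧ SuffixNonneg u := by
  constructor
  · intro hgood
    induction w with
    | nil => obtain ⟨u, v, h, -⟩ := hgood; simp [reduceW] at h
    | cons p ps ih =>
      obtain ⟨u, v, h, hv⟩ := hgood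
      cases hp : p.2 with
      | A =>
        rw [reduceW_cons_A hp] at h
        cases u with
        | nil =>
          simp only [List.nil_append, List.cons.injEq] at h
          refine ⟨[], ps, by simp [h.1], ?_, trivial⟩
          rw [maxInitialSum_eq_countP, h.2, countP_A_eq_zero_iff.2 hv, Nat.cast_zero]
        | cons q qs =>
          simp only [List.cons_append, List.cons.injEq] at h
          obtain ⟨u', v', rfl, hv', hu'⟩ := ih ⟨qs, v, h.2, hv⟩
          refine ⟨p :: u', v', by simp, hv', ?_, hu'⟩
          have := hu'.wordSum_nonneg
          simp only [wordSum, hp, Letter.weight]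
          omega
      | R =>
        rcases reduceW_R_cases hp ps with ⟨h1, h2⟩ | ⟨q, qs, hq, h1, h2⟩
        · have hm : (γ, Letter.A) ∈ p :: reduceW ps := by rw [← h2, h]; simp
          rcases List.mem_cons.1 hm with rfl | hm
          · simp at hp
          · exact absurd (h1 _ hm) (by simp)
        · have h3 : reduceW ps = (q :: u) ++ (γ, Letter.A) :: v := by
            rw [h1, ← h2, h, List.cons_append]
          obtain ⟨u', v', rfl, hv', hu'⟩ := ih ⟨q :: u, v, h3, hv⟩
          refine ⟨p :: u', v', by simp, hv', ?_, hu'⟩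
          have h4 := maxInitialSum_append_cons (γ := γ) hv' hu'
          rw [maxInitialSum_eq_countP, h3, List.cons_append, List.countP_cons_of_pos (by simp [hq]),
            List.countP_append, List.countP_cons_of_pos (by simp)] at h4
          simp only [wordSum, hp, Letter.weight]
          push_cast at h4
          omega
  · rintro ⟨u, v, rfl, hv, hu⟩
    induction u with
    | nil =>
      refine ⟨[], reduceW v, reduceW_cons_A rfl v, ?_⟩
      rw [maxInitialSum_eq_countP, Nat.cast_eq_zero] at hv
      exact countP_A_eq_zero_iff.1 hv
    | cons p ps ih =>
      obtain ⟨u', v', h, hv'⟩ := ih hu.2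
      cases hp : p.2 with
      | A => exact ⟨p :: u', v', by rw [List.cons_append, reduceW_cons_A hp, h]; rfl, hv'⟩
      | R =>
        have hu1 := hu.1
        simp only [wordSum, hp, Letter.weight] at hu1
        have h4 := maxInitialSum_append_cons (γ := γ) hv hu.2
        rw [maxInitialSum_eq_countP, h] at h4
        rcases reduceW_R_cases hp (ps ++ (γ, Letter.A) :: v) with ⟨h1, h2⟩ | ⟨q, qs, hq, h1, h2⟩
        · rw [h] at h1
          exact absurd (h1 (γ, Letter.A) (by simp)) (by simp)
        · cases u' with
          | nil =>
            rw [List.nil_append, List.countP_cons_of_pos (by simp),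
              countP_A_eq_zero_iff.2 hv'] at h4
            push_cast at h4
            omega
          | cons q' u' =>
            refine ⟨u', v', ?_, hv'⟩
            rw [List.cons_append, h2]
            rw [h, List.cons_append, List.cons.injEq] at h1
            exact h1.2.symm

/-- Weights of the initial segments of a word whose letters sit, in decreasing order, at the nonzero places
of a function on the integers smaller than `b`. -/
lemma maxInitialSum_le_iff (f : ℤ → ℤ) (key : Node l × Letter → ℤ)
    (v : List (Node l × Letter)) (b : ℤ) (hsort : v.Pairwise (fun p q => key q < key p))
    (hv : ∀ p ∈ v, key p < b ∧ p.2.weight = f (key p))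
    (hf : ∀ y < b, f y ≠ 0 → ∃ p ∈ v, key p = y) (m : ℤ) :
    maxInitialSum v ≤ m ↔ ∀ a ≤ b, ∑ y ∈ Finset.Ico a b, f y ≤ m := by
  induction v generalizing b m with
  | nil =>
    have h0 : ∀ a, ∑ y ∈ Finset.Ico a b, f y = 0 := fun a =>
      Finset.sum_eq_zero fun y hy => by
        by_contra h
        obtain ⟨p, hp, -⟩ := hf y (Finset.mem_Ico.1 hy).2 h
        simp at hp
    simp only [h0, maxInitialSum]
    exact ⟨fun h _ _ => h, fun h => h b le_rfl⟩
  | cons p ps ih =>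
    rw [List.pairwise_cons] at hsort
    obtain ⟨hpb, hpf⟩ := hv p (by simp)
    have hzero : ∀ y, key p < y → y < b → f y = 0 := by
      intro y hy hyb
      by_contra h
      obtain ⟨q, hq, hqy⟩ := hf y hyb h
      rcases List.mem_cons.1 hq with rfl | hq
      · omega
      · have := hsort.1 q hq
        omega
    have ih' := ih (key p) hsort.2
      (fun q hq => ⟨hsort.1 q hq, (hv q (List.mem_cons_of_mem _ hq)).2⟩)
      (fun y hy hy0 => by
        obtain ⟨q, hq, hqy⟩ := hf y (hy.trans hpb) hy0
        rcases List.mem_cons.1 hq with rfl | hq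
        · omega
        · exact ⟨q, hq, hqy⟩) (m - p.2.weight)
    have hbig : ∀ a, key p < a → ∑ y ∈ Finset.Ico a b, f y = 0 := fun a ha =>
      Finset.sum_eq_zero fun y hy => hzero y (by have := (Finset.mem_Ico.1 hy).1; omega)
        (Finset.mem_Ico.1 hy).2
    have hsmall : ∀ a ≤ key p, ∑ y ∈ Finset.Ico a b, f y =
        ∑ y ∈ Finset.Ico a (key p), f y + p.2.weight := by
      intro a ha
      have h1 : Finset.Ico a b = Finset.Ico a (key p) ∪ Finset.Ico (key p) b := by
        ext y; simp only [Finset.mem_union, Finset.mem_Ico]; omega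
      have h2 : Disjoint (Finset.Ico a (key p)) (Finset.Ico (key p) b) := by
        rw [Finset.disjoint_left]
        intro y; simp only [Finset.mem_Ico]; omega
      rw [h1, Finset.sum_union h2, ← Finset.add_sum_Ioo_eq_sum_Ico hpb, ← hpf,
        Finset.sum_eq_zero (s := Finset.Ioo (key p) b), add_zero]
      intro y hy
      exact hzero y (Finset.mem_Ioo.1 hy).1 (Finset.mem_Ioo.1 hy).2
    rw [maxInitialSum, max_le_iff, ← le_sub_iff_add_le', ih']
    constructor
    · rintro ⟨h0, h⟩ a ha
      rcases lt_or_ge (key p) a with hk | hk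
      · rw [hbig a hk]; exact h0
      · rw [hsmall a hk]
        have := h a hk
        omega
    · intro h
      refine ⟨by simpa using h b le_rfl, fun a ha => ?_⟩
      have := h a (ha.trans hpb.le)
      rw [hsmall a ha] at this
      omega

/-- Suffix weights of a word whose letters sit, in decreasing order, at the nonzero places
of a function on the integers in `(b, t]`. -/
lemma suffixNonneg_iff (f : ℤ → ℤ) (key : Node l × Letter → ℤ)
    (u : List (Node l × Letter)) (b t : ℤ) (hbt : b ≤ t)
    (hsort : u.Pairwise (fun p q => key q < key p))
    (hu : ∀ p ∈ u, b < key p ∧ key p ≤ t ∧ p.2.weight = f (key p))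
    (hf : ∀ y, b < y → y ≤ t → f y ≠ 0 → ∃ p ∈ u, key p = y) :
    wordSum u = ∑ y ∈ Finset.Ioc b t, f y ∧
      (SuffixNonneg u ↔ ∀ a, b ≤ a → a ≤ t → 0 ≤ ∑ y ∈ Finset.Ioc b a, f y) := by
  induction u generalizing t with
  | nil =>
    have h0 : ∀ a ≤ t, ∑ y ∈ Finset.Ioc b a, f y = 0 := fun a hat =>
      Finset.sum_eq_zero fun y hy => by
        by_contra h
        obtain ⟨p, hp, -⟩ := hf y (Finset.mem_Ioc.1 hy).1 ((Finset.mem_Ioc.1 hy).2.trans hat) h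
        simp at hp
    exact ⟨by simp [wordSum, h0 t le_rfl], fun _ a _ ha => (h0 a ha).ge, fun _ => trivial⟩
  | cons p ps ih =>
    rw [List.pairwise_cons] at hsort
    obtain ⟨hbp, hpt, hpf⟩ := hu p (by simp)
    have hzero : ∀ y, key p < y → y ≤ t → f y = 0 := by
      intro y hy hyt
      by_contra h
      obtain ⟨q, hq, hqy⟩ := hf y (hbp.trans hy) hyt h
      rcases List.mem_cons.1 hq with rfl | hq
      · omega
      · have := hsort.1 q hq
        omega
    obtain ⟨ih1, ih2⟩ := ih (key p - 1) (by omega) hsort.2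
      (fun q hq => ⟨(hu q (List.mem_cons_of_mem _ hq)).1, by have := hsort.1 q hq; omega,
        (hu q (List.mem_cons_of_mem _ hq)).2.2⟩)
      (fun y hy hyt hy0 => by
        obtain ⟨q, hq, hqy⟩ := hf y hy (by omega) hy0
        rcases List.mem_cons.1 hq with rfl | hq
        · omega
        · exact ⟨q, hq, hqy⟩)
    have hlarge : ∀ a, key p ≤ a → a ≤ t → ∑ y ∈ Finset.Ioc b a, f y = wordSum (p :: ps) := by
      intro a ha hat
      have h1 : Finset.Ioc b a = Finset.Ioc b (key p - 1) ∪ Finset.Ico (key p) (a + 1) := by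
        ext y; simp only [Finset.mem_Ioc, Finset.mem_union, Finset.mem_Ico]; omega
      have h2 : Disjoint (Finset.Ioc b (key p - 1)) (Finset.Ico (key p) (a + 1)) := by
        rw [Finset.disjoint_left]
        intro y; simp only [Finset.mem_Ioc, Finset.mem_Ico]; omega
      rw [h1, Finset.sum_union h2, ← ih1, wordSum,
        ← Finset.add_sum_Ioo_eq_sum_Ico (show key p < a + 1 by omega), ← hpf,
        Finset.sum_eq_zero (s := Finset.Ioo (key p) (a + 1))]
      · ring
      · intro y hy
        rw [Finset.mem_Ioo] at hy
        exact hzero y hy.1 (by omega)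
    refine ⟨(hlarge t hpt le_rfl).symm, ?_⟩
    rw [SuffixNonneg, ih2]
    constructor
    · rintro ⟨h0, h⟩ a hba hat
      rcases lt_or_ge a (key p) with hk | hk
      · exact h a hba (by omega)
      · rw [hlarge a hk hat]; exact h0
    · intro h
      exact ⟨(hlarge t hpt le_rfl) ▸ h t hbt le_rfl, fun a hba hat => h a hba (by omega)⟩

/-! ### Beads -/

/-- `x` is a bead of the partition `π` of charge `t`, i.e. the content of the last box of
one of its (possibly empty) rows. -/
def Bead (π : Partition) (t x : ℤ) : Prop := ∃ r : ℕ, 1 ≤ r ∧ (π.part r : ℤ) - r + t = x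

lemma Bead.add_iff {π : Partition} {t x d : ℤ} : Bead π (t + d) (x + d) ↔ Bead π t x := by
  refine exists_congr fun r => and_congr_right fun _ => ?_
  omega

lemma Partition.part_le_part (π : Partition) {a b : ℕ} (ha : 1 ≤ a) (hab : a ≤ b) :
    π.part b ≤ π.part a := by
  induction b, hab using Nat.le_induction with
  | base => exact le_rfl
  | succ b hab ih => exact (π.antitone b (ha.trans hab)).trans ih

lemma Partition.row_eq (π : Partition) {a b : ℕ} (ha : 1 ≤ a) (hb : 1 ≤ b)
    (h : (π.part a : ℤ) - a = π.part b - b) : a = b := by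
  rcases lt_trichotomy a b with hab | hab | hab
  · have := π.part_le_part ha hab.le; omega
  · exact hab
  · have := π.part_le_part hb hab.le; omega

lemma bead_of_lt (π : Partition) (t : ℤ) : ∃ N : ℤ, ∀ x < N, Bead π t x := by
  obtain ⟨N, hN⟩ := π.eventually_zero
  refine ⟨t - N, fun x hx => ⟨(t - x).toNat, by omega, ?_⟩⟩
  rw [hN _ (by omega)]
  omega

lemma not_bead_of_le (π : Partition) (t : ℤ) : ∃ N : ℤ, ∀ x, N ≤ x → ¬ Bead π t x := by
  refine ⟨π.part 1 + t, ?_⟩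
  rintro x hx ⟨r, hr, rfl⟩
  have := π.part_le_part le_rfl hr
  omega

lemma addable_bead {Λ : MultiPartition l} {γ : Node l} (s : Fin (l + 1) → ℤ)
    (h : Addable Λ γ) :
    Bead (Λ γ.comp) (s γ.comp) (content s γ - 1) ∧
      ¬ Bead (Λ γ.comp) (s γ.comp) (content s γ) := by
  obtain ⟨h1, h2, h3⟩ := h
  unfold content
  refine ⟨⟨γ.row, h1, by omega⟩, ?_⟩
  rintro ⟨r, hr, h⟩
  rcases lt_or_ge r γ.row with hlt | hge
  · have := (Λ γ.comp).part_le_part hr (show r ≤ γ.row - 1 by omega)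
    omega
  · have := (Λ γ.comp).part_le_part h1 hge
    omega

lemma removable_bead {Λ : MultiPartition l} {γ : Node l} (s : Fin (l + 1) → ℤ)
    (h : Removable Λ γ) :
    ¬ Bead (Λ γ.comp) (s γ.comp) (content s γ - 1) ∧
      Bead (Λ γ.comp) (s γ.comp) (content s γ) := by
  obtain ⟨h1, h2, h3, h4⟩ := h
  unfold content
  refine ⟨?_, γ.row, h1, by omega⟩
  rintro ⟨r, hr, h⟩
  rcases lt_or_ge γ.row r with hlt | hge
  · have := (Λ γ.comp).part_le_part (show 1 ≤ γ.row + 1 by omega) (show γ.row + 1 ≤ r by omega)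
    omega
  · have := (Λ γ.comp).part_le_part hr hge
    omega

lemma exists_addable {Λ : MultiPartition l} {s : Fin (l + 1) → ℤ} {c : Fin (l + 1)} {x : ℤ}
    (h1 : Bead (Λ c) (s c) (x - 1)) (h2 : ¬ Bead (Λ c) (s c) x) :
    ∃ γ : Node l, γ.comp = c ∧ content s γ = x ∧ Addable Λ γ := by
  obtain ⟨r, hr, h⟩ := h1
  refine ⟨⟨r, (Λ c).part r + 1, c⟩, rfl, by simp only [content]; push_cast; omega,
    hr, rfl, ?_⟩
  by_contra! hcon
  refine h2 ⟨r - 1, by have := hcon.1; simp only at this; omega, ?_⟩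
  have h3 := hcon.2
  have h4 := hcon.1
  simp only at h3 h4
  have := (Λ c).part_le_part (show 1 ≤ r - 1 by omega) (show r - 1 ≤ r by omega)
  omega

lemma exists_removable {Λ : MultiPartition l} {s : Fin (l + 1) → ℤ} {c : Fin (l + 1)} {x : ℤ}
    (h1 : ¬ Bead (Λ c) (s c) (x - 1)) (h2 : Bead (Λ c) (s c) x) :
    ∃ γ : Node l, γ.comp = c ∧ content s γ = x ∧ Removable Λ γ := by
  obtain ⟨r, hr, h⟩ := h2
  have h3 : (Λ c).part (r + 1) < (Λ c).part r := by
    by_contra! hcon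
    refine h1 ⟨r + 1, by omega, ?_⟩
    have := (Λ c).antitone r hr
    push_cast
    omega
  exact ⟨⟨r, (Λ c).part r, c⟩, rfl, by simp only [content]; omega, hr, by simp only; omega, rfl, h3⟩

lemma not_addable_and_removable {Λ : MultiPartition l} {γ : Node l} (h : Addable Λ γ)
    (h' : Removable Λ γ) : False := by
  have := h.2.1
  have := h'.2.2.1
  omega

/-- A node which is addable or removable is determined by its component and content. -/
lemma node_eq_of_content {Λ : MultiPartition l} {s : Fin (l + 1) → ℤ} {γ δ : Node l}
    (hγ : Addable Λ γ ∨ Removable Λ γ) (hδ : Addable Λ δ ∨ Removable Λ δ)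
    (hc : γ.comp = δ.comp) (hx : content s γ = content s δ) : γ = δ := by
  obtain ⟨r, b, c⟩ := γ
  obtain ⟨r', b', c'⟩ := δ
  simp only at hc
  subst hc
  rcases hγ with hγ | hγ <;> rcases hδ with hδ | hδ
  · obtain ⟨h1, h2, -⟩ := hγ
    obtain ⟨h1', h2', -⟩ := hδ
    simp only [content] at h1 h2 h1' h2' hx
    obtain rfl : r = r' := (Λ c).row_eq h1 h1' (by omega)
    rw [h2, h2']
  · have h1 := (addable_bead s hγ).2
    have h2 := (removable_bead s hδ).2
    exact absurd (hx ▸ h2) h1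
  · have h1 := (addable_bead s hδ).2
    have h2 := (removable_bead s hγ).2
    exact absurd (hx ▸ h2) h1
  · obtain ⟨h1, -, h2, -⟩ := hγ
    obtain ⟨h1', -, h2', -⟩ := hδ
    simp only [content] at h1 h2 h1' h2' hx
    obtain rfl : r = r' := (Λ c).row_eq h1 h1' (by omega)
    rw [h2, h2']

/-! ### The periodic extension of the components -/

/-- The component indexed by an integer, periodically. -/
def compAt (l : ℕ) (z : ℤ) : Fin (l + 1) :=
  ⟨(z % ((l : ℤ) + 1)).toNat, by
    have h1 := Int.emod_nonneg z (show (l : ℤ) + 1 ≠ 0 by omega)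
    have h2 := Int.emod_lt_of_pos z (show (0 : ℤ) < (l : ℤ) + 1 by omega)
    omega⟩

/-- The quasi-periodic extension of the multicharge to the integers. -/
def chargeAt (e : ℕ) (s : Fin (l + 1) → ℤ) (z : ℤ) : ℤ :=
  s (compAt l z) + e * (z / ((l : ℤ) + 1))

/-- The beads of the component indexed by an integer. -/
def BeadAt (e : ℕ) (s : Fin (l + 1) → ℤ) (Λ : MultiPartition l) (z x : ℤ) : Prop :=
  Bead (Λ (compAt l z)) (chargeAt e s z) x

/-- The integer index of the component in which a node of residue `i` has content `i`. -/
def nodeKey (e : ℕ) (s : Fin (l + 1) → ℤ) (i : ℤ) (γ : Node l) : ℤ :=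
  (γ.comp : ℕ) + ((l : ℤ) + 1) * ((i - content s γ) / e)

open Classical in
/-- The weight of the letter at place `z` of the word of content `j` of a family of beads. -/
noncomputable def letterAt (B : ℤ → ℤ → Prop) (j z : ℤ) : ℤ :=
  (if B z (j - 1) then 1 else 0) - if B z j then 1 else 0

lemma compAt_add_mul (c : Fin (l + 1)) (q : ℤ) :
    compAt l ((c : ℕ) + ((l : ℤ) + 1) * q) = c ∧
      (((c : ℕ) + ((l : ℤ) + 1) * q : ℤ) / ((l : ℤ) + 1)) = q := by
  have hc := c.2
  have h1 : ((c : ℕ) : ℤ) % ((l : ℤ) + 1) = (c : ℕ) := Int.emod_eq_of_lt (by omega) (by omega)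
  refine ⟨Fin.ext ?_, ?_⟩
  · simp only [compAt, Int.add_mul_emod_self_left, h1]
    omega
  · rw [Int.add_mul_ediv_left _ _ (by omega), Int.ediv_eq_zero_of_lt (by omega) (by omega), zero_add]

lemma compAt_val_add (z : ℤ) :
    ((compAt l z : ℕ) : ℤ) + ((l : ℤ) + 1) * (z / ((l : ℤ) + 1)) = z := by
  have h1 := Int.emod_nonneg z (show (l : ℤ) + 1 ≠ 0 by omega)
  have h2 := Int.emod_add_mul_ediv z ((l : ℤ) + 1)
  simp only [compAt]
  omega

lemma nodeKey_spec {e : ℕ} {s : Fin (l + 1) → ℤ} {i : ℤ} {γ : Node l}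
    (h : content s γ % (e : ℤ) = i) :
    compAt l (nodeKey e s i γ) = γ.comp ∧
      content s γ + e * (nodeKey e s i γ / ((l : ℤ) + 1)) = i := by
  obtain ⟨h1, h2⟩ := compAt_add_mul γ.comp ((i - content s γ) / e)
  refine ⟨h1, ?_⟩
  rw [nodeKey, h2, Int.mul_ediv_cancel']
  · ring
  · rw [← h]
    exact ⟨-(content s γ / e), by have := Int.emod_add_mul_ediv (content s γ) e; linarith⟩

lemma nodeKey_eq {e : ℕ} (he : 0 < e) {s : Fin (l + 1) → ℤ} {i z : ℤ} {γ : Node l}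
    (h1 : compAt l z = γ.comp) (h2 : content s γ + e * (z / ((l : ℤ) + 1)) = i) :
    nodeKey e s i γ = z := by
  rw [nodeKey, ← h1, ← h2, add_sub_cancel_left, Int.mul_ediv_cancel_left _ (by omega)]
  exact compAt_val_add z

lemma nodeLt_iff {e : ℕ} (he : 0 < e) {s : Fin (l + 1) → ℤ} {i : ℤ} {γ δ : Node l}
    (hγ : content s γ % (e : ℤ) = i) (hδ : content s δ % (e : ℤ) = i) :
    NodeLt s γ δ ↔ nodeKey e s i δ < nodeKey e s i γ := by
  obtain ⟨h1, h2⟩ := nodeKey_spec hγ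
  obtain ⟨h1', h2'⟩ := nodeKey_spec hδ
  have h3 := compAt_val_add (l := l) (nodeKey e s i γ)
  have h3' := compAt_val_add (l := l) (nodeKey e s i δ)
  rw [h1] at h3
  rw [h1'] at h3'
  set q := nodeKey e s i γ / ((l : ℤ) + 1)
  set q' := nodeKey e s i δ / ((l : ℤ) + 1)
  rw [← h3, ← h3', NodeLt, Fin.lt_def]
  have hc := γ.comp.2
  have hc' := δ.comp.2
  rcases lt_trichotomy q q' with h | h | h
  · have ha : (e : ℤ) * q < e * q' := by gcongr
    have hb : ((l : ℤ) + 1) * (q + 1) ≤ (l + 1) * q' := by gcongr; omega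
    rw [mul_add] at hb
    omega
  · rw [h] at h2 ⊢
    omega
  · have ha : (e : ℤ) * q' < e * q := by gcongr
    have hb : ((l : ℤ) + 1) * (q' + 1) ≤ (l + 1) * q := by gcongr; omega
    rw [mul_add] at hb
    omega

lemma beadAt_iff {e : ℕ} {s : Fin (l + 1) → ℤ} {Λ : MultiPartition l} {z x : ℤ} :
    BeadAt e s Λ z x ↔
      Bead (Λ (compAt l z)) (s (compAt l z)) (x - e * (z / ((l : ℤ) + 1))) := by
  rw [BeadAt, chargeAt, ← Bead.add_iff (x := x - _) (d := e * (z / ((l : ℤ) + 1))), sub_add_cancel]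

lemma letterAt_of_addable {e : ℕ} {s : Fin (l + 1) → ℤ} {Λ : MultiPartition l} {i : ℤ}
    {γ : Node l} (hi : content s γ % (e : ℤ) = i) (h : Addable Λ γ) :
    letterAt (BeadAt e s Λ) i (nodeKey e s i γ) = 1 := by
  obtain ⟨h1, h2⟩ := nodeKey_spec hi
  obtain ⟨h3, h4⟩ := addable_bead s h
  rw [letterAt, if_pos, if_neg, sub_zero]
  · rwa [beadAt_iff, h1, ← eq_sub_of_add_eq h2]
  · rwa [beadAt_iff, h1, sub_right_comm, ← eq_sub_of_add_eq h2]

lemma letterAt_of_removable {e : ℕ} {s : Fin (l + 1) → ℤ} {Λ : MultiPartition l} {i : ℤ}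
    {γ : Node l} (hi : content s γ % (e : ℤ) = i) (h : Removable Λ γ) :
    letterAt (BeadAt e s Λ) i (nodeKey e s i γ) = -1 := by
  obtain ⟨h1, h2⟩ := nodeKey_spec hi
  obtain ⟨h3, h4⟩ := removable_bead s h
  rw [letterAt, if_neg, if_pos, zero_sub]
  · rwa [beadAt_iff, h1, ← eq_sub_of_add_eq h2]
  · rwa [beadAt_iff, h1, sub_right_comm, ← eq_sub_of_add_eq h2]

lemma exists_node_of_letterAt {e : ℕ} (he : 0 < e) {s : Fin (l + 1) → ℤ}
    {Λ : MultiPartition l} {i z : ℤ} (hi : 0 ≤ i) (hie : i < e)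
    (h : letterAt (BeadAt e s Λ) i z ≠ 0) :
    ∃ γ : Node l, (Addable Λ γ ∨ Removable Λ γ) ∧ content s γ % (e : ℤ) = i ∧
      nodeKey e s i γ = z := by
  suffices hs : ∃ γ : Node l, (Addable Λ γ ∨ Removable Λ γ) ∧ γ.comp = compAt l z ∧
      content s γ = i - e * (z / ((l : ℤ) + 1)) by
    obtain ⟨γ, h1, h2, h3⟩ := hs
    refine ⟨γ, h1, ?_, nodeKey_eq he h2.symm (by rw [h3]; ring)⟩
    rw [h3, Int.sub_mul_emod_self_left, Int.emod_eq_of_lt hi hie]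
  by_cases h1 : BeadAt e s Λ z (i - 1) <;> by_cases h2 : BeadAt e s Λ z i
  · simp [letterAt, h1, h2] at h
  · rw [beadAt_iff] at h1 h2
    rw [sub_right_comm] at h1
    obtain ⟨γ, h3, h4, h5⟩ := exists_addable h1 h2
    exact ⟨γ, Or.inl h5, h3, h4⟩
  · rw [beadAt_iff] at h1 h2
    rw [sub_right_comm] at h1
    obtain ⟨γ, h3, h4, h5⟩ := exists_removable h1 h2
    exact ⟨γ, Or.inr h5, h3, h4⟩
  · simp [letterAt, h1, h2] at h

/-! ### Words and letters indexed by integers -/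

lemma finite_letterAt_ne_zero {e : ℕ} (he : 0 < e) (s : Fin (l + 1) → ℤ)
    (Λ : MultiPartition l) (i : ℤ) : {z | letterAt (BeadAt e s Λ) i z ≠ 0}.Finite := by
  choose N hN using fun c => bead_of_lt (Λ c) (s c)
  choose M hM using fun c => not_bead_of_le (Λ c) (s c)
  obtain ⟨n, hn⟩ := (Set.finite_range N).bddBelow
  obtain ⟨m, hm⟩ := (Set.finite_range M).bddAbove
  have hinj : Function.Injective fun z : ℤ => (compAt l z, z / ((l : ℤ) + 1)) := by
    intro z z' h
    rw [Prod.mk.injEq] at h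
    rw [← compAt_val_add (l := l) z, h.1, h.2, compAt_val_add]
  refine (((Set.finite_univ (α := Fin (l + 1))).prod
    (Set.finite_Icc (min 0 (i - 1 - m)) (max 0 (i - n)))).preimage hinj.injOn).subset ?_
  intro z hz
  by_contra hcon
  simp only [Set.mem_preimage, Set.mem_prod, Set.mem_univ, true_and, Set.mem_Icc, not_and_or,
    not_le] at hcon
  refine hz ?_
  set q := z / ((l : ℤ) + 1) with hq
  rcases hcon with h | h
  · have h1 : (e : ℤ) * q ≤ 1 * q := by
      apply mul_le_mul_of_nonpos_right <;> omega
    have h2 : ∀ x, m + q ≤ x → ¬ BeadAt e s Λ z x := by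
      intro x hx
      rw [beadAt_iff, ← hq]
      refine hM _ _ ((hm (Set.mem_range_self _)).trans ?_)
      omega
    rw [letterAt, if_neg (h2 _ (by omega)), if_neg (h2 _ (by omega)), sub_zero]
  · have h1 : 1 * q ≤ (e : ℤ) * q := by
      apply mul_le_mul_of_nonneg_right <;> omega
    have h2 : ∀ x, x ≤ i → BeadAt e s Λ z x := by
      intro x hx
      rw [beadAt_iff, ← hq]
      refine hN _ _ (lt_of_lt_of_le ?_ (hn (Set.mem_range_self _)))
      omega
    rw [letterAt, if_pos (h2 _ (by omega)), if_pos (h2 _ (by omega)), sub_self]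

lemma exists_isWordE {e : ℕ} (he : 0 < e) (s : Fin (l + 1) → ℤ) (Λ : MultiPartition l)
    {i : ℤ} (hi : 0 ≤ i) (hie : i < e) : ∃ w, IsWordE Λ s e i w := by
  classical
  have hfin := finite_letterAt_ne_zero he s Λ i
  have hex : ∀ z : ℤ, ∃ p : Node l × Letter, letterAt (BeadAt e s Λ) i z ≠ 0 →
      ((Addable Λ p.1 ∨ Removable Λ p.1) ∧ content s p.1 % (e : ℤ) = i ∧
        nodeKey e s i p.1 = z) ∧ LetterOk Λ p := by
    intro z
    by_cases hz : letterAt (BeadAt e s Λ) i z = 0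
    · exact ⟨(⟨0, 0, 0⟩, Letter.A), fun h => absurd hz h⟩
    obtain ⟨γ, h1, h2⟩ := exists_node_of_letterAt he hi hie hz
    rcases h1 with h1 | h1
    · refine ⟨(γ, Letter.A), fun _ => ⟨⟨Or.inl h1, h2⟩, by simp [h1], ?_⟩⟩
      simpa using fun h => not_addable_and_removable h1 h
    · refine ⟨(γ, Letter.R), fun _ => ⟨⟨Or.inr h1, h2⟩, ?_, by simp [h1]⟩⟩
      simpa using fun h => not_addable_and_removable h h1
  choose f hf using hex
  have hmem : ∀ z, z ∈ hfin.toFinset.sort (· ≥ ·) ↔ letterAt (BeadAt e s Λ) i z ≠ 0 := by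
    intro z
    rw [Finset.mem_sort, Set.Finite.mem_toFinset, Set.mem_ofPred_eq]
  refine ⟨(hfin.toFinset.sort (· ≥ ·)).map f, ?_, ?_, ?_⟩
  · rw [List.pairwise_map]
    have hs : (hfin.toFinset.sort (· ≥ ·)).Pairwise (· > ·) := Finset.sortedGT_sort _ |>.pairwise
    refine hs.imp_of_mem ?_
    intro z z' hz hz' hzz
    obtain ⟨-, h1, h2⟩ := (hf z ((hmem z).1 hz)).1
    obtain ⟨-, h1', h2'⟩ := (hf z' ((hmem z').1 hz')).1
    rw [nodeLt_iff he h1 h1', h2, h2']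
    exact hzz
  · intro γ
    simp only [List.mem_map, hmem]
    constructor
    · rintro ⟨x, z, hz, hx⟩
      have h1 := (hf z hz).1
      rw [hx] at h1
      exact ⟨h1.1, h1.2.1⟩
    · rintro ⟨h1, h2⟩
      have hz : letterAt (BeadAt e s Λ) i (nodeKey e s i γ) ≠ 0 := by
        rcases h1 with h1 | h1
        · rw [letterAt_of_addable h2 h1]; decide
        · rw [letterAt_of_removable h2 h1]; decide
      obtain ⟨h3, h4, h5⟩ := (hf _ hz).1
      refine ⟨(f (nodeKey e s i γ)).2, _, hz, Prod.ext ?_ rfl⟩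
      obtain ⟨h6, h7⟩ := nodeKey_spec h2
      obtain ⟨h6', h7'⟩ := nodeKey_spec h4
      rw [h5] at h6' h7'
      have h8 : content s (f (nodeKey e s i γ)).1 = content s γ := by omega
      exact node_eq_of_content h3 h1 (h6'.symm.trans h6) h8
  · intro p hp
    obtain ⟨z, hz, rfl⟩ := List.mem_map.1 hp
    exact (hf z ((hmem z).1 hz)).2

lemma weight_eq_letterAt {e : ℕ} {s : Fin (l + 1) → ℤ} {Λ : MultiPartition l} {i : ℤ}
    {w : List (Node l × Letter)} (hw : IsWordE Λ s e i w) {p : Node l × Letter} (hp : p ∈ w) :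
    p.2.weight = letterAt (BeadAt e s Λ) i (nodeKey e s i p.1) := by
  obtain ⟨-, h2, h3⟩ := hw
  have hi := ((h2 p.1).1 ⟨p.2, hp⟩).2
  have hok := h3 p hp
  cases hp2 : p.2 with
  | A => rw [letterAt_of_addable hi (hok.1.1 hp2)]; rfl
  | R => rw [letterAt_of_removable hi (hok.2.1 hp2)]; rfl

lemma goodAddableWord_iff_letterAt {e : ℕ} (he : 0 < e) {s : Fin (l + 1) → ℤ}
    {Λ : MultiPartition l} {i : ℤ} (hi : 0 ≤ i) (hie : i < e) {w : List (Node l × Letter)}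
    (hw : IsWordE Λ s e i w) (γ : Node l) :
    GoodAddableWord w γ ↔ Addable Λ γ ∧ content s γ % (e : ℤ) = i ∧
      (∀ a ≤ nodeKey e s i γ,
        ∑ y ∈ Finset.Ico a (nodeKey e s i γ), letterAt (BeadAt e s Λ) i y ≤ 0) ∧
      ∀ a, nodeKey e s i γ ≤ a →
        0 ≤ ∑ y ∈ Finset.Ioc (nodeKey e s i γ) a, letterAt (BeadAt e s Λ) i y := by
  set f := letterAt (BeadAt e s Λ) i with hf
  set key : Node l × Letter → ℤ := fun p => nodeKey e s i p.1 with hkey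
  have hsort : w.Pairwise (fun p q => key q < key p) := by
    refine hw.1.imp_of_mem ?_
    intro p q hp hq h
    exact (nodeLt_iff he ((hw.2.1 p.1).1 ⟨p.2, hp⟩).2 ((hw.2.1 q.1).1 ⟨q.2, hq⟩).2).1 h
  have hcomplete : ∀ y, f y ≠ 0 → ∃ p ∈ w, key p = y := by
    intro y hy
    obtain ⟨δ, h1, h2, h3⟩ := exists_node_of_letterAt he hi hie hy
    obtain ⟨x, hx⟩ := (hw.2.1 δ).2 ⟨h1, h2⟩
    exact ⟨(δ, x), hx, h3⟩
  have hsplit : ∀ u v, w = u ++ (γ, Letter.A) :: v →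
      (maxInitialSum v = 0 ∧ SuffixNonneg u ↔
        (∀ a ≤ nodeKey e s i γ, ∑ y ∈ Finset.Ico a (nodeKey e s i γ), f y ≤ 0) ∧
        ∀ a, nodeKey e s i γ ≤ a → 0 ≤ ∑ y ∈ Finset.Ioc (nodeKey e s i γ) a, f y) := by
    intro u v huv
    have hweight : ∀ p ∈ w, p.2.weight = f (key p) := fun p hp => weight_eq_letterAt hw hp
    rw [huv, List.pairwise_append, List.pairwise_cons] at hsort
    obtain ⟨hu, ⟨hγv, hv⟩, huv'⟩ := hsort
    have huγ : ∀ p ∈ u, key (γ, Letter.A) < key p := fun p hp => huv' p hp _ (by simp)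
    have hmax : maxInitialSum v = 0 ↔ maxInitialSum v ≤ 0 := by
      refine ⟨fun h => h.le, fun h => le_antisymm h ?_⟩
      cases v with
      | nil => exact le_rfl
      | cons p ps => exact le_max_left _ _
    refine and_congr ?_ ?_
    · rw [hmax]
      refine maxInitialSum_le_iff f key v (key (γ, Letter.A)) hv
        (fun p hp => ⟨hγv p hp, hweight p (by simp [huv, hp])⟩) ?_ 0
      intro y hy hy0
      obtain ⟨p, hp, rfl⟩ := hcomplete y hy0
      rw [huv, List.mem_append, List.mem_cons] at hp
      rcases hp with hp | rfl | hp
      · exact absurd (huγ p hp) (by omega)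
      · omega
      · exact ⟨p, hp, rfl⟩
    · have hbdd : ∀ t, (∀ p ∈ u, key p ≤ t) → key (γ, Letter.A) ≤ t →
          (SuffixNonneg u ↔ ∀ a, key (γ, Letter.A) ≤ a → a ≤ t →
            0 ≤ ∑ y ∈ Finset.Ioc (key (γ, Letter.A)) a, f y) := by
        intro t ht hγt
        refine (suffixNonneg_iff f key u (key (γ, Letter.A)) t hγt hu
          (fun p hp => ⟨huγ p hp, ht p hp, hweight p (by simp [huv, hp])⟩) ?_).2
        intro y hy hyt hy0
        obtain ⟨p, hp, rfl⟩ := hcomplete y hy0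
        rw [huv, List.mem_append, List.mem_cons] at hp
        rcases hp with hp | rfl | hp
        · exact ⟨p, hp, rfl⟩
        · omega
        · exact absurd (hγv p hp) (by omega)
      obtain ⟨t, ht⟩ := ((u.map key).toFinset : Set ℤ).toFinite.bddAbove
      have ht' : ∀ p ∈ u, key p ≤ t := fun p hp => ht (by simpa using ⟨p.1, p.2, hp, rfl⟩)
      constructor
      · intro h a ha
        exact (hbdd (max a t) (fun p hp => (ht' p hp).trans (le_max_right _ _))
          (ha.trans (le_max_left _ _))).1 h a ha (le_max_left _ _)
      · intro h
        exact (hbdd (max (key (γ, Letter.A)) t) (fun p hp => (ht' p hp).trans (le_max_right _ _))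
          (le_max_left _ _)).2 fun a ha _ => h a ha
  rw [goodAddableWord_iff]
  constructor
  · rintro ⟨u, v, huv, h⟩
    have hmem : (γ, Letter.A) ∈ w := by simp [huv]
    exact ⟨(hw.2.2 _ hmem).1.1 rfl, ((hw.2.1 γ).1 ⟨_, hmem⟩).2, (hsplit u v huv).1 h⟩
  · rintro ⟨h1, h2, h3⟩
    obtain ⟨x, hx⟩ := (hw.2.1 γ).2 ⟨Or.inl h1, h2⟩
    obtain rfl : x = Letter.A := (hw.2.2 _ hx).1.2 h1
    obtain ⟨u, v, huv⟩ := List.append_of_mem hx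
    exact ⟨u, v, huv, (hsplit u v huv).2 h3⟩

lemma goodAddable_iff {e : ℕ} (he : 0 < e) {s : Fin (l + 1) → ℤ}
    {Λ : MultiPartition l} {i : ℤ} (hi : 0 ≤ i) (hie : i < e) (γ : Node l) :
    GoodAddable Λ s e i γ ↔ Addable Λ γ ∧ content s γ % (e : ℤ) = i ∧
      (∀ a ≤ nodeKey e s i γ,
        ∑ y ∈ Finset.Ico a (nodeKey e s i γ), letterAt (BeadAt e s Λ) i y ≤ 0) ∧
      ∀ a, nodeKey e s i γ ≤ a →
        0 ≤ ∑ y ∈ Finset.Ioc (nodeKey e s i γ) a, letterAt (BeadAt e s Λ) i y := by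
  constructor
  · rintro ⟨w, hw, h⟩
    exact (goodAddableWord_iff_letterAt he hi hie hw γ).1 h
  · intro h
    obtain ⟨w, hw⟩ := exists_isWordE he s Λ hi hie
    exact ⟨w, hw, (goodAddableWord_iff_letterAt he hi hie hw γ).2 h⟩

/-! ### Comparison of the words of a multipartition and of its reduction -/

lemma letterAt_congr {B B' : ℤ → ℤ → Prop} {j z z' : ℤ} (h1 : B z (j - 1) ↔ B' z' (j - 1))
    (h2 : B z j ↔ B' z' j) : letterAt B j z = letterAt B' j z' := by
  rw [letterAt, letterAt, propext h1, propext h2]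

/-- The partial sums of the letters controlling the good addable node are preserved when the
beads of `B` above `T` move one place up. -/
lemma sum_letterAt_reduction {B B' : ℤ → ℤ → Prop} {T : ℤ → ℤ} (hT : Monotone T)
    (hgap : ∀ z, ¬ B z (T z)) (hfull : ∀ z x, T (z - 1) ≤ x → x < T z → B z x)
    (hB' : ∀ z x, B' z x ↔ if x < T (z - 1) then B z x else B (z - 1) x)
    {j z₀ : ℤ} (hj : T z₀ < j)
    (hleft : ∀ a ≤ z₀, ∑ y ∈ Finset.Ico a z₀, letterAt B j y ≤ 0)
    (hright : ∀ a, z₀ ≤ a → 0 ≤ ∑ y ∈ Finset.Ioc z₀ a, letterAt B j y) :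
    (∀ a ≤ z₀ + 1, ∑ y ∈ Finset.Ico a (z₀ + 1), letterAt B' j y ≤ 0) ∧
      ∀ a, z₀ + 1 ≤ a → 0 ≤ ∑ y ∈ Finset.Ioc (z₀ + 1) a, letterAt B' j y := by
  have hBlt : ∀ z x, x < T z → (B' (z + 1) x ↔ B (z + 1) x) := fun z x hx => by
    rw [hB', add_sub_cancel_right, if_pos hx]
  have hBge : ∀ z x, T z ≤ x → (B' (z + 1) x ↔ B z x) := fun z x hx => by
    rw [hB', add_sub_cancel_right, if_neg hx.not_gt]
  have hlow : ∀ z, T z < j → letterAt B' j (z + 1) = letterAt B j z := fun z hz =>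
    letterAt_congr (hBge z _ (by omega)) (hBge z _ hz.le)
  constructor
  · intro a ha
    have h := hleft (a - 1) (by omega)
    have h1 : Finset.Ico a (z₀ + 1) = (Finset.Ico (a - 1) z₀).map (addRightEmbedding 1) := by
      rw [Finset.map_add_right_Ico, sub_add_cancel]
    rw [h1, Finset.sum_map]
    refine le_of_eq_of_le (Finset.sum_congr rfl fun y hy => ?_) h
    exact hlow y (lt_of_le_of_lt (hT (Finset.mem_Ico.1 hy).2.le) hj)
  · have hsucc : ∀ (f : ℤ → ℤ) (b a : ℤ), b ≤ a →
        ∑ y ∈ Finset.Ioc b (a + 1), f y = ∑ y ∈ Finset.Ioc b a, f y + f (a + 1) := by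
      intro f b a hba
      have h1 : Finset.Ioc b (a + 1) = insert (a + 1) (Finset.Ioc b a) := by
        ext y; simp only [Finset.mem_Ioc, Finset.mem_insert]; omega
      rw [h1, Finset.sum_insert (by simp), add_comm]
    set F := fun a => ∑ y ∈ Finset.Ioc z₀ a, letterAt B j y with hF
    set F' := fun a => ∑ y ∈ Finset.Ioc (z₀ + 1) a, letterAt B' j y with hF'
    have hB0 : ∀ z, T (z - 1) < j → j < T z → letterAt B j z = 0 := by
      intro z h1 h2
      rw [letterAt, if_pos (hfull z _ (by omega) (by omega)), if_pos (hfull z _ (by omega) h2),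
        sub_self]
    have hB1 : ∀ z, T (z - 1) < j → T z = j → letterAt B j z = 1 := by
      intro z h1 h2
      rw [letterAt, if_pos (hfull z _ (by omega) (by omega)), if_neg (h2 ▸ hgap z), sub_zero]
    suffices h : ∀ a, z₀ + 1 ≤ a → 0 ≤ F' a ∧ (T a < j → F' a = F (a - 1)) ∧
        (T a = j → F' a = F a - 1) ∧ (j < T a → F' a = F a) from fun a ha => (h a ha).1
    intro a ha
    induction a, ha using Int.leInduction with
    | base =>
      have h1 : F' (z₀ + 1) = 0 := by simp [hF']
      have h2 : F z₀ = 0 := by simp [hF]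
      have h3 : F (z₀ + 1) = F z₀ + letterAt B j (z₀ + 1) := hsucc _ _ _ le_rfl
      refine ⟨h1.ge, fun _ => by rw [add_sub_cancel_right]; omega, fun h => ?_, fun h => ?_⟩
      · rw [hB1 _ (by rwa [add_sub_cancel_right]) h] at h3
        omega
      · rw [hB0 _ (by rwa [add_sub_cancel_right]) h] at h3
        omega
    | succ a ha ih =>
      obtain ⟨h0, hlt, heq, hgt⟩ := ih
      have h1 : F' (a + 1) = F' a + letterAt B' j (a + 1) := hsucc _ _ _ ha
      have h2 : F (a + 1) = F a + letterAt B j (a + 1) := hsucc _ _ _ (by omega)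
      have h3 : F (a - 1 + 1) = F (a - 1) + letterAt B j (a - 1 + 1) := hsucc _ _ _ (by omega)
      rw [sub_add_cancel] at h3
      have hF0 : 0 ≤ F a := hright a (by omega)
      have hF1 : 0 ≤ F (a + 1) := hright (a + 1) (by omega)
      have hmono : T a ≤ T (a + 1) := hT (by omega)
      rcases lt_trichotomy (T a) j with h | h | h
      · have h4 := hlow a h
        have h5 := hlt h
        refine ⟨by omega, fun _ => by rw [add_sub_cancel_right]; omega, fun h' => ?_, fun h' => ?_⟩
        · rw [hB1 _ (by rwa [add_sub_cancel_right]) h'] at h2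
          omega
        · rw [hB0 _ (by rwa [add_sub_cancel_right]) h'] at h2
          omega
      · have h5 := heq h
        have hBa : ¬ B a j := h ▸ hgap a
        have h6 : ¬ B' (a + 1) j := fun h' => hBa ((hBge a j h.le).1 h')
        have h7 := hBlt a (j - 1) (by omega)
        have h8 : 0 ≤ letterAt B' j (a + 1) := by
          rw [letterAt, if_neg h6]
          split_ifs <;> omega
        refine ⟨by omega, fun h' => by omega, fun h' => ?_, fun h' => ?_⟩
        · have h9 : ¬ B (a + 1) j := fun hb => hgap (a + 1) (h' ▸ hb)
          have h10 : letterAt B' j (a + 1) = letterAt B j (a + 1) :=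
            letterAt_congr h7 (iff_of_false h6 h9)
          omega
        · have h9 : B (a + 1) j := hfull _ _ (by rw [add_sub_cancel_right]; omega) h'
          have h10 : letterAt B' j (a + 1) - 1 = letterAt B j (a + 1) := by
            rw [letterAt, letterAt, if_neg h6, if_pos h9, propext h7, sub_zero]
          omega
      · have h5 := hgt h
        have h6 : letterAt B' j (a + 1) = letterAt B j (a + 1) :=
          letterAt_congr (hBlt a _ (by omega)) (hBlt a _ h)
        exact ⟨by omega, fun _ => by omega, fun _ => by omega, fun _ => by omega⟩

/-! ### Numbers of large parts -/

/-- The number of parts of size at least `v`, for `v ≥ 1`. -/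
noncomputable def Partition.len (π : Partition) (v : ℕ) : ℕ := sInf {n | π.part (n + 1) < v}

lemma Partition.le_part_iff (π : Partition) {v r : ℕ} (hv : 1 ≤ v) (hr : 1 ≤ r) :
    v ≤ π.part r ↔ r ≤ π.len v := by
  have hne : {n | π.part (n + 1) < v}.Nonempty := by
    obtain ⟨N, hN⟩ := π.eventually_zero
    exact ⟨N, by simp only [Set.mem_ofPred_eq]; rw [hN _ (by omega)]; omega⟩
  constructor
  · intro h
    by_contra! hcon
    have h1 : π.part (π.len v + 1) < v := Nat.sInf_mem hne
    have h2 := π.part_le_part (show 1 ≤ π.len v + 1 by omega) (show π.len v + 1 ≤ r by omega)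
    omega
  · intro h
    by_contra! hcon
    have h1 : π.len v ≤ r - 1 := Nat.sInf_le (by
      simp only [Set.mem_ofPred_eq]
      rwa [Nat.sub_add_cancel hr])
    omega

lemma Partition.len_anti (π : Partition) {v w : ℕ} (hv : 1 ≤ v) (hvw : v ≤ w) :
    π.len w ≤ π.len v := by
  by_contra! hcon
  have h1 := (π.le_part_iff (v := w) (r := π.len w) (by omega) (by omega)).2 le_rfl
  have h2 := (π.le_part_iff (v := v) (r := π.len w) hv (by omega)).1 (hvw.trans h1)
  omega

lemma Partition.len_eq_zero (π : Partition) {v : ℕ} (hv : π.part 1 < v) : π.len v = 0 := by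
  by_contra! hcon
  have := (π.le_part_iff (v := v) (r := 1) (by omega) le_rfl).2 (by omega)
  omega

lemma countParts_add_len (π : Partition) {v : ℕ} (hv : 1 ≤ v) :
    countParts π v + π.len (v + 1) = π.len v := by
  have h1 : countParts π v = (Finset.Ioc (π.len (v + 1)) (π.len v)).card := by
    refine Nat.subtype_card _ fun r => ?_
    rw [Finset.mem_Ioc]
    constructor
    · rintro ⟨h1, h2⟩
      have hr : 1 ≤ r := by omega
      have h3 := π.le_part_iff (v := v + 1) (by omega) hr
      have h4 := π.le_part_iff hv hr
      omega
    · rintro ⟨hr, h⟩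
      have h3 := π.le_part_iff (v := v + 1) (by omega) hr
      have h4 := π.le_part_iff hv hr
      omega
  have h2 := π.len_anti hv (show v ≤ v + 1 by omega)
  rw [Nat.card_Ioc] at h1
  omega

lemma part_eq_of_len_eq {π π' : Partition} {α r : ℕ} (h : ∀ v, α < v → π.len v = π'.len v)
    (hr : 1 ≤ r) (hα : α < π'.part r) : π.part r = π'.part r := by
  have h1 := π.le_part_iff (v := π'.part r) (by omega) hr
  have h2 := π'.le_part_iff (v := π'.part r) (by omega) hr
  have h3 := π.le_part_iff (v := π'.part r + 1) (by omega) hr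
  have h4 := π'.le_part_iff (v := π'.part r + 1) (by omega) hr
  rw [h _ (by omega)] at h1 h3
  omega

lemma bead_iff_len {π : Partition} {t x : ℤ} :
    Bead π t x ↔ ∃ v : ℕ, (π.len (v + 1) : ℤ) < v + t - x ∧ (v = 0 ∨ (v : ℤ) + t - x ≤ π.len v) := by
  constructor
  · rintro ⟨r, hr, rfl⟩
    have h1 := π.le_part_iff (v := π.part r + 1) (by omega) hr
    refine ⟨π.part r, by omega, ?_⟩
    rcases Nat.eq_zero_or_pos (π.part r) with h | h
    · exact Or.inl h
    · have h2 := π.le_part_iff h hr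
      right
      omega
  · rintro ⟨v, h1, h2⟩
    have hr : 1 ≤ ((v : ℤ) + t - x).toNat := by omega
    have h3 := π.le_part_iff (v := v + 1) (by omega) hr
    refine ⟨_, hr, ?_⟩
    rcases Nat.eq_zero_or_pos v with h | h
    · omega
    · have h4 := π.le_part_iff h hr
      omega

lemma not_bead_edge (π : Partition) (t : ℤ) (α : ℕ) :
    ¬ Bead π t (α + (t - π.len (α + 1))) := by
  rw [bead_iff_len]
  rintro ⟨v, h1, h2⟩
  rcases Nat.lt_or_ge α v with h | h
  · have := π.len_anti (show 1 ≤ α + 1 by omega) (show α + 1 ≤ v by omega)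
    omega
  · have := π.len_anti (show 1 ≤ v + 1 by omega) (show v + 1 ≤ α + 1 by omega)
    omega

lemma bead_of_edge {π : Partition} {t x : ℤ} {α : ℕ} (h1 : t - π.len α ≤ x)
    (h2 : x < t - π.len (α + 1)) : Bead π t (α + x) :=
  bead_iff_len.2 ⟨α, by omega, Or.inr (by omega)⟩

lemma bead_glue {π π₀ π₁ : Partition} {t₀ t₁ : ℤ} {α : ℕ} (hα : 1 ≤ α)
    (hgt : ∀ v, α < v → π.len v = π₀.len v)
    (hle : ∀ v, 1 ≤ v → v ≤ α → (π.len v : ℤ) = π₁.len v + t₀ - t₁)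
    (hedge : t₀ - π₀.len (α + 1) ≤ t₁ - π₁.len (α + 1)) (x : ℤ) :
    Bead π t₀ x ↔ if x < α + (t₀ - π₀.len (α + 1)) then Bead π₁ t₁ x else Bead π₀ t₀ x := by
  have hα' := hgt (α + 1) (by omega)
  have hle' := hle α hα le_rfl
  split_ifs with hx <;> simp only [bead_iff_len] <;> refine exists_congr fun v => ?_
  · rcases lt_trichotomy v α with h | rfl | h
    · rw [hle (v + 1) (by omega) (by omega)]
      rcases Nat.eq_zero_or_pos v with h0 | h0
      · omega
      · rw [hle v h0 h.le]
        omega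
    · omega
    · have h1 := π₀.len_anti (show 1 ≤ α + 1 by omega) (show α + 1 ≤ v by omega)
      have h2 := π₁.len_anti (show 1 ≤ α + 1 by omega) (show α + 1 ≤ v by omega)
      rw [hgt v h]
      omega
  · rcases Nat.lt_or_ge α v with h | h
    · rw [hgt v h, hgt (v + 1) (by omega)]
    · have h1 := π₀.len_anti (show 1 ≤ v + 1 by omega) (show v + 1 ≤ α + 1 by omega)
      have h2 := π.len_anti (show 1 ≤ v + 1 by omega) (show v + 1 ≤ α + 1 by omega)
      omega

lemma len_psi_of_lt {e α : ℕ} {P : ℕ → Node l} {Λ μ : MultiPartition l}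
    (hμ : IsPsi e P α Λ μ) (C : Fin (l + 1)) {v : ℕ} (hv : α < v) :
    (μ C).len v = (Λ (prevComp C)).len v := by
  have key : ∀ k v, α < v → (μ C).part 1 + (Λ (prevComp C)).part 1 < v + k →
      (μ C).len v = (Λ (prevComp C)).len v := by
    intro k
    induction k with
    | zero =>
      intro v _ h
      rw [(μ C).len_eq_zero (by omega), (Λ (prevComp C)).len_eq_zero (by omega)]
    | succ k ih =>
      intro v hv h
      have h1 := countParts_add_len (μ C) (show 1 ≤ v by omega)
      have h2 := countParts_add_len (Λ (prevComp C)) (show 1 ≤ v by omega)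
      have h3 := hμ C v (by omega)
      rw [if_neg (by omega), if_neg (by omega)] at h3
      rw [← h1, ← h2, h3, ih (v + 1) (by omega) (by omega)]
  exact key ((μ C).part 1 + (Λ (prevComp C)).part 1 + 1) v hv (by omega)

lemma len_psi_of_le {e α : ℕ} {P : ℕ → Node l} {Λ μ : MultiPartition l}
    (hμ : IsPsi e P α Λ μ) (C : Fin (l + 1))
    (hP : NalP e P C + (Λ C).len (α + 1) ≤ (Λ C).len α) {v : ℕ} (hv : 1 ≤ v) (hvα : v ≤ α) :
    (μ C).len v + NalP e P C + (Λ C).len (α + 1) =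
      (Λ C).len v + (Λ (prevComp C)).len (α + 1) := by
  induction hvα using Nat.decreasingInduction with
  | self =>
    have h1 := countParts_add_len (μ C) hv
    have h2 := countParts_add_len (Λ C) hv
    have h3 := hμ C α hv
    have h4 := len_psi_of_lt hμ C (Nat.lt_succ_self α)
    rw [if_neg (by omega), if_pos rfl] at h3
    simp only [Nat.succ_eq_add_one] at h4
    omega
  | of_succ v hvα ih =>
    have ih := ih (by omega)
    have h1 := countParts_add_len (μ C) hv
    have h2 := countParts_add_len (Λ C) hv
    have h3 := hμ C v hv
    rw [if_pos (by omega)] at h3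
    omega

/-! ### Edges of the periodic extension -/

/-- The number of parts of size at least `v`, measured from the charge, in the component
indexed by an integer. -/
noncomputable def edge (e : ℕ) (s : Fin (l + 1) → ℤ) (Λ : MultiPartition l) (v : ℕ) (z : ℤ) : ℤ :=
  chargeAt e s z - (Λ (compAt l z)).len v

lemma compAt_add_period (z q : ℤ) : compAt l (z + ((l : ℤ) + 1) * q) = compAt l z := by
  simp only [compAt, Int.add_mul_emod_self_left]

lemma compAt_val (c : Fin (l + 1)) :
    compAt l (c : ℕ) = c ∧ ((c : ℕ) : ℤ) / ((l : ℤ) + 1) = 0 := by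
  simpa using compAt_add_mul c 0

lemma edge_add_period (e : ℕ) (s : Fin (l + 1) → ℤ) (Λ : MultiPartition l) (v : ℕ) (z q : ℤ) :
    edge e s Λ v (z + ((l : ℤ) + 1) * q) = edge e s Λ v z + e * q := by
  rw [edge, edge, chargeAt, chargeAt, compAt_add_period, Int.add_mul_ediv_left _ _ (by omega)]
  ring

lemma compAt_succ (z : ℤ) :
    (∃ c : Fin l, compAt l z = c.castSucc ∧ compAt l (z + 1) = c.succ ∧
        (z + 1) / ((l : ℤ) + 1) = z / ((l : ℤ) + 1)) ∨
      (compAt l z = Fin.last l ∧ compAt l (z + 1) = 0 ∧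
        (z + 1) / ((l : ℤ) + 1) = z / ((l : ℤ) + 1) + 1) := by
  have hz := compAt_val_add (l := l) z
  set q := z / ((l : ℤ) + 1)
  induction h : compAt l z using Fin.lastCases with
  | last =>
    right
    obtain ⟨h1, h2⟩ := compAt_add_mul (0 : Fin (l + 1)) (q + 1)
    have h3 : z + 1 = ((0 : Fin (l + 1)) : ℕ) + ((l : ℤ) + 1) * (q + 1) := by
      rw [h, Fin.val_last] at hz
      rw [Fin.val_zero, mul_add]
      omega
    exact ⟨rfl, h3 ▸ h1, h3 ▸ h2⟩
  | cast c =>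
    left
    obtain ⟨h1, h2⟩ := compAt_add_mul c.succ q
    have h3 : z + 1 = (c.succ : ℕ) + ((l : ℤ) + 1) * q := by
      rw [h, Fin.val_castSucc] at hz
      rw [Fin.val_succ]
      omega
    exact ⟨c, rfl, h3 ▸ h1, h3 ▸ h2⟩

lemma rho_compAt (z : ℤ) : rho l (compAt l z) = compAt l (z + 1) := by
  rcases compAt_succ (l := l) z with ⟨c, h1, h2, -⟩ | ⟨h1, h2, -⟩
  · rw [h1, h2, rho]
    exact finRotate_of_lt c.2
  · rw [h1, h2, rho, finRotate_last]

lemma prevComp_compAt (z : ℤ) : prevComp (compAt l (z + 1)) = compAt l z := by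
  rw [prevComp, ← rho_compAt, Equiv.symm_apply_apply]

lemma chargeAt_xiCharge (e : ℕ) (s : Fin (l + 1) → ℤ) (z : ℤ) :
    chargeAt e (xiCharge e s) (z + 1) = chargeAt e s z := by
  have h := prevComp_compAt (l := l) z
  rw [prevComp] at h
  rw [chargeAt, chargeAt, xiCharge, h]
  rcases compAt_succ (l := l) z with ⟨c, -, h2, h3⟩ | ⟨-, h2, h3⟩
  · rw [h2, h3, if_neg (Fin.succ_ne_zero c), sub_zero]
  · rw [h2, h3, if_pos rfl]
    ring

lemma edge_mono {e : ℕ} {s : Fin (l + 1) → ℤ} {Λ : MultiPartition l} (he : 0 < e) (hs : InSe e s)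
    (hcyl : Cylindric e s Λ) {v : ℕ} (hv : 1 ≤ v) : Monotone (edge e s Λ v) := by
  refine monotone_int_of_le_succ fun z => ?_
  suffices h : ∃ d : ℕ, chargeAt e s (z + 1) = chargeAt e s z + d ∧ ∀ a, 1 ≤ a →
      (Λ (compAt l (z + 1))).part (a + d) ≤ (Λ (compAt l z)).part a by
    obtain ⟨d, h1, h2⟩ := h
    rw [edge, edge, h1]
    by_contra! hcon
    have h3 := h2 ((Λ (compAt l z)).len v + 1) (by omega)
    have h4 := ((Λ (compAt l (z + 1))).le_part_iff hv
      (show 1 ≤ (Λ (compAt l z)).len v + 1 + d by omega)).2 (by omega)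
    have h5 := ((Λ (compAt l z)).le_part_iff hv
      (show 1 ≤ (Λ (compAt l z)).len v + 1 by omega)).1 (h4.trans h3)
    omega
  rw [chargeAt, chargeAt]
  rcases compAt_succ (l := l) z with ⟨c, h1, h2, h3⟩ | ⟨h1, h2, h3⟩
  · rw [h1, h2, h3]
    have h4 := hs c.castSucc c.succ Fin.castSucc_lt_succ
    exact ⟨_, by omega, hcyl.1 c⟩
  · rw [h1, h2, h3]
    have h4 : s (Fin.last l) - s 0 < e := by
      rcases eq_or_ne (Fin.last l) 0 with h | h
      · rw [h]; omega
      · exact (hs 0 (Fin.last l) (Fin.pos_iff_ne_zero.2 h)).2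
    exact ⟨_, by rw [mul_add]; omega, hcyl.2⟩

lemma RightmostAt.edge_bounds {e : ℕ} {s : Fin (l + 1) → ℤ} {Λ : MultiPartition l} {α : ℕ}
    {γ : Node l} (hα : 1 ≤ α) (h : RightmostAt Λ α γ) {z : ℤ} (hz : compAt l z = γ.comp) :
    edge e s Λ α z ≤ content s γ + e * (z / ((l : ℤ) + 1)) - α ∧
      content s γ + e * (z / ((l : ℤ) + 1)) - α < edge e s Λ (α + 1) z := by
  obtain ⟨h1, h2, h3⟩ := h
  have h4 := (Λ γ.comp).le_part_iff hα h1
  have h5 := (Λ γ.comp).le_part_iff (v := α + 1) (by omega) h1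
  rw [edge, edge, chargeAt, hz, content, h2]
  omega

lemma exists_rightmostAt {e : ℕ} {s : Fin (l + 1) → ℤ} {Λ : MultiPartition l} {α : ℕ}
    (hα : 1 ≤ α) {z x : ℤ} (h1 : edge e s Λ α z ≤ x) (h2 : x < edge e s Λ (α + 1) z) :
    ∃ γ : Node l, RightmostAt Λ α γ ∧ γ.comp = compAt l z ∧
      content s γ + e * (z / ((l : ℤ) + 1)) = α + x := by
  rw [edge] at h1 h2
  have hr : 1 ≤ (chargeAt e s z - x).toNat := by omega
  have h4 := (Λ (compAt l z)).le_part_iff hα hr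
  have h5 := (Λ (compAt l z)).le_part_iff (v := α + 1) (by omega) hr
  refine ⟨⟨(chargeAt e s z - x).toNat, α, compAt l z⟩, ⟨hr, rfl, by simp only; omega⟩, rfl, ?_⟩
  simp only [content]
  rw [chargeAt] at *
  omega

lemma Covers.exists_edge {e : ℕ} {s : Fin (l + 1) → ℤ} {Λ : MultiPartition l} {α : ℕ}
    (he : 0 < e) (hα : 1 ≤ α) (h : Covers e s Λ α) (x : ℤ) :
    ∃ z, edge e s Λ α z ≤ x ∧ x < edge e s Λ (α + 1) z := by
  obtain ⟨γ, h1, h2⟩ := h ((x + α) % e) (Int.emod_nonneg _ (by omega))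
    (Int.emod_lt_of_pos _ (by omega))
  obtain ⟨k, hk⟩ : (e : ℤ) ∣ x + α - content s γ := (Int.ModEq.dvd h2)
  obtain ⟨h3, h4⟩ := compAt_add_mul γ.comp k
  have h5 := h1.edge_bounds (e := e) (s := s) hα h3
  rw [h4, ← hk] at h5
  exact ⟨(γ.comp : ℕ) + ((l : ℤ) + 1) * k, by omega, by omega⟩

/-- Consecutive components overlap on the parts of a size whose residues cover everything. -/
lemma Covers.edge_succ_le {e : ℕ} {s : Fin (l + 1) → ℤ} {Λ : MultiPartition l} {α : ℕ}
    (he : 0 < e) (hs : InSe e s) (hcyl : Cylindric e s Λ) (hα : 1 ≤ α) (h : Covers e s Λ α)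
    (z : ℤ) : edge e s Λ α (z + 1) ≤ edge e s Λ (α + 1) z := by
  by_contra! hcon
  obtain ⟨z', h1, h2⟩ := h.exists_edge he hα (edge e s Λ (α + 1) z)
  rcases lt_or_ge z z' with hz | hz
  · have := edge_mono he hs hcyl hα (show z + 1 ≤ z' by omega)
    omega
  · have := edge_mono he hs hcyl (show 1 ≤ α + 1 by omega) hz
    omega

section Pseudoperiod

section Pseudoperiod

variable {e α : ℕ} {s : Fin (l + 1) → ℤ} {Λ : MultiPartition l} {P : ℕ → Node l}

lemma exists_rightmostAt_of_lt (he : 0 < e) (hs : InSe e s) (hcyl : Cylindric e s Λ)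
    (hα : 1 ≤ α) (hcov : Covers e s Λ α) {k : ℕ} (hk : k < e) :
    ∃ γ : Node l, RightmostAt Λ α γ ∧ content s γ = α + edge e s Λ (α + 1) l - 1 - k ∧
      edge e s Λ (α + 1) ((γ.comp : ℕ) - 1) ≤ edge e s Λ (α + 1) l - 1 - k := by
  have hmono := edge_mono (Λ := Λ) he hs hcyl (show 1 ≤ α + 1 by omega)
  have hper : edge e s Λ (α + 1) l = edge e s Λ (α + 1) (-1) + e := by
    have := edge_add_period e s Λ (α + 1) (-1) 1
    rw [mul_one, mul_one] at this
    rw [← this]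
    congr 1
    ring
  set x := edge e s Λ (α + 1) l - 1 - k with hx
  obtain ⟨z, hz, hmin⟩ := Int.exists_least_of_bdd (P := fun z => x < edge e s Λ (α + 1) z)
    ⟨0, fun z hz => by
      by_contra! hcon
      have := hmono (show z ≤ -1 by omega)
      omega⟩ ⟨l, by omega⟩
  have hz0 : 0 ≤ z := by
    by_contra! hcon
    have := hmono (show z ≤ -1 by omega)
    omega
  have hzl : z ≤ l := hmin l (by omega)
  have hprev : edge e s Λ (α + 1) (z - 1) ≤ x := by
    by_contra! hcon
    have := hmin _ hcon
    omega
  have h1 := hcov.edge_succ_le he hs hcyl hα (z - 1)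
  rw [sub_add_cancel] at h1
  obtain ⟨γ, h2, h3, h4⟩ := exists_rightmostAt hα (h1.trans hprev) hz
  have h5 : z / ((l : ℤ) + 1) = 0 := Int.ediv_eq_zero_of_lt hz0 (by omega)
  have h6 := compAt_val_add (l := l) z
  rw [h5, mul_zero, add_zero] at h4 h6
  rw [← h3] at h6
  exact ⟨γ, h2, by omega, by rwa [h6]⟩

lemma IsFirstPseudoperiod.content_eq (he : 0 < e) (hs : InSe e s) (hcyl : Cylindric e s Λ)
    (hP : IsFirstPseudoperiod e s Λ α P) {k : ℕ} (hk : k < e) :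
    content s (P k) = α + edge e s Λ (α + 1) l - 1 - k := by
  obtain ⟨hα, hcov, -, hright, hmax, -, hnext⟩ := hP
  induction k with
  | zero =>
    obtain ⟨γ, h1, h2, -⟩ := exists_rightmostAt_of_lt he hs hcyl hα hcov hk
    have h3 := hmax γ h1
    obtain ⟨hc, hc'⟩ := compAt_val (P 0).comp
    have h4 := ((hright 0 hk).edge_bounds (e := e) (s := s) hα hc).2
    have h5 := edge_mono (Λ := Λ) he hs hcyl (show 1 ≤ α + 1 by omega)
      (show (((P 0).comp : ℕ) : ℤ) ≤ l by have := (P 0).comp.2; omega)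
    rw [hc', mul_zero] at h4
    push_cast at h2 ⊢
    omega
  | succ k ih =>
    have ih := ih (by omega)
    obtain ⟨γ, h1, h2, -⟩ := exists_rightmostAt_of_lt he hs hcyl hα hcov hk
    obtain ⟨h3, h4, -⟩ := hnext k hk
    have h5 := h4 γ h1 (by omega)
    push_cast at h2 ⊢
    omega

lemma IsFirstPseudoperiod.edge_comp_le (he : 0 < e) (hs : InSe e s) (hcyl : Cylindric e s Λ)
    (hP : IsFirstPseudoperiod e s Λ α P) {k : ℕ} (hk : k < e) :
    edge e s Λ (α + 1) (((P k).comp : ℕ) - 1) ≤ edge e s Λ (α + 1) l - 1 - k ∧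
      edge e s Λ (α + 1) l - 1 - k < edge e s Λ (α + 1) ((P k).comp : ℕ) := by
  have hcont := hP.content_eq he hs hcyl hk
  obtain ⟨hα, hcov, -, hright, -, hmin, hnext⟩ := hP
  have hmono := edge_mono (Λ := Λ) he hs hcyl (show 1 ≤ α + 1 by omega)
  constructor
  · obtain ⟨γ, h1, h2, h3⟩ := exists_rightmostAt_of_lt he hs hcyl hα hcov hk
    have h4 : (P k).comp ≤ γ.comp := by
      cases k with
      | zero => exact hmin γ h1 (by omega)
      | succ k => exact (hnext k hk).2.2 γ h1 (by omega)
    rw [Fin.le_def] at h4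
    exact (hmono (by omega)).trans h3
  · obtain ⟨hc, hc'⟩ := compAt_val (P k).comp
    have h4 := ((hright k hk).edge_bounds (e := e) (s := s) hα hc).2
    rw [hc', mul_zero] at h4
    omega

lemma IsFirstPseudoperiod.nalP_eq (he : 0 < e) (hs : InSe e s) (hcyl : Cylindric e s Λ)
    (hP : IsFirstPseudoperiod e s Λ α P) (z : ℤ) :
    (NalP e P (compAt l z) : ℤ) = edge e s Λ (α + 1) z - edge e s Λ (α + 1) (z - 1) := by
  have hper : edge e s Λ (α + 1) l = edge e s Λ (α + 1) (-1) + e := by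
    have := edge_add_period e s Λ (α + 1) (-1) 1
    rw [mul_one, mul_one] at this
    rw [← this]
    congr 1
    ring
  have hz := compAt_val_add (l := l) z
  set c := compAt l z with hc
  set n := edge e s Λ (α + 1) with hn
  have hmono : Monotone n := fun _ _ h => edge_mono he hs hcyl (by omega) h
  have h1 : n z = n (c : ℕ) + e * (z / ((l : ℤ) + 1)) := by
    rw [hn, ← edge_add_period, hz]
  have h2 : n (z - 1) = n ((c : ℕ) - 1) + e * (z / ((l : ℤ) + 1)) := by
    rw [hn, ← edge_add_period, sub_add_eq_add_sub, hz]
  have h3 : n (c : ℕ) ≤ n l := hmono (by have := c.2; omega)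
  have h4 : n (-1) ≤ n ((c : ℕ) - 1) := hmono (by omega)
  have h5 : n ((c : ℕ) - 1) ≤ n (c : ℕ) := hmono (by omega)
  have h6 : NalP e P c = (Finset.Ico (n l - n (c : ℕ)).toNat (n l - n ((c : ℕ) - 1)).toNat).card := by
    refine Nat.subtype_card _ fun k => ?_
    rw [Finset.mem_Ico]
    constructor
    · rintro ⟨ha, hb⟩
      have hk : k < e := by omega
      refine ⟨hk, ?_⟩
      obtain ⟨h6, h7⟩ := hP.edge_comp_le he hs hcyl hk
      rw [← hn] at h6 h7
      rcases lt_trichotomy ((P k).comp : ℕ) (c : ℕ) with h | h | h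
      · have := hmono (show (((P k).comp : ℕ) : ℤ) ≤ (c : ℕ) - 1 by omega)
        omega
      · exact Fin.ext h
      · have := hmono (show ((c : ℕ) : ℤ) ≤ ((P k).comp : ℕ) - 1 by omega)
        omega
    · rintro ⟨hk, hcomp⟩
      obtain ⟨h6, h7⟩ := hP.edge_comp_le he hs hcyl hk
      rw [← hn] at h6 h7
      rw [hcomp] at h6 h7
      omega
  rw [h6, Nat.card_Ico]
  omega

lemma beadAt_psi (he : 0 < e) (hs : InSe e s) (hcyl : Cylindric e s Λ)
    (hP : IsFirstPseudoperiod e s Λ α P) {μ : MultiPartition l} (hμ : IsPsi e P α Λ μ)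
    (z x : ℤ) :
    BeadAt e (xiCharge e s) μ z x ↔
      if x < α + edge e s Λ (α + 1) (z - 1) then BeadAt e s Λ z x else BeadAt e s Λ (z - 1) x := by
  obtain ⟨z, rfl⟩ : ∃ y, z = y + 1 := ⟨z - 1, by ring⟩
  have hα := hP.1
  have h1 := hP.nalP_eq he hs hcyl (z + 1)
  have h2 := hP.2.1.edge_succ_le he hs hcyl hα z
  have hmono := edge_mono (Λ := Λ) he hs hcyl (show 1 ≤ α + 1 by omega) (show z ≤ z + 1 by omega)
  rw [add_sub_cancel_right] at h1 ⊢
  simp only [edge] at h1 h2 hmono ⊢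
  unfold BeadAt
  rw [chargeAt_xiCharge]
  refine bead_glue (α := α) hα ?_ ?_ hmono x
  · intro v hv
    rw [len_psi_of_lt hμ _ hv, prevComp_compAt]
  · intro v hv hvα
    have h3 := len_psi_of_le hμ (compAt l (z + 1)) (by omega) hv hvα
    rw [prevComp_compAt] at h3
    omega

end Pseudoperiod

lemma nodeKey_xiNode {e : ℕ} (he : 0 < e) {s : Fin (l + 1) → ℤ} {i : ℤ} {γ : Node l}
    (h : content s γ % (e : ℤ) = i) :
    nodeKey e (xiCharge e s) i (xiNode γ) = nodeKey e s i γ + 1 ∧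
      content (xiCharge e s) (xiNode γ) % (e : ℤ) = i := by
  obtain ⟨h1, h2⟩ := nodeKey_spec h
  have h3 : compAt l (nodeKey e s i γ + 1) = (xiNode γ).comp := by
    rw [← rho_compAt, h1, xiNode]
  have h4 : content (xiCharge e s) (xiNode γ) +
      e * ((nodeKey e s i γ + 1) / ((l : ℤ) + 1)) = i := by
    have h5 := chargeAt_xiCharge e s (nodeKey e s i γ)
    rw [chargeAt, chargeAt, h3, h1] at h5
    rw [content] at h2 ⊢
    simp only [xiNode] at h5 ⊢
    omega
  refine ⟨nodeKey_eq he h3 h4, ?_⟩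
  rw [eq_sub_of_add_eq h4, Int.sub_mul_emod_self_left, ← h, Int.emod_emod]

end Pseudoperiod

/-!
STATEMENT 17 (Lemma 5.3 of the paper): if γ⁺ = (a, λ^c_a + 1, c) is the good addable
i-node of (λ, s) with λ^c_a > α, then the good addable i-node of (ψ(λ), ξ(s)) is
Γ⁺ = (a, λ^c_a + 1, c+1) for c < l, and Γ⁺ = (a, λ^c_a + 1, 1) for c = l (i.e. the
component index is rotated by ρ).
-/
theorem good_addable_node_of_reduction_big_part_case
    (l e : ℕ) (he : 2 ≤ e) (s : Fin (l + 1) → ℤ) (Λ μ : MultiPartition l)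
    (α : ℕ) (P : ℕ → Node l) (i : ℕ) (hi : i < e)
    (hs : InSe e s) (hcyl : Cylindric e s Λ) (hnf : ¬ FLOTW e s Λ)
    (hP : IsFirstPseudoperiod e s Λ α P)
    (hμ : IsPsi e P α Λ μ)
    (a : ℕ) (c : Fin (l + 1)) (ha : 1 ≤ a)
    (hbig : α < (Λ c).part a)
    (hgood : GoodAddable Λ s e (i : ℤ) ⟨a, (Λ c).part a + 1, c⟩) :
    GoodAddable μ (xiCharge e s) e (i : ℤ) ⟨a, (Λ c).part a + 1, rho l c⟩ := by
  have he0 : 0 < e := by omega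
  have hα := hP.1
  rw [goodAddable_iff he0 (by omega) (by omega)] at hgood ⊢
  obtain ⟨hadd, hres, hleft, hright⟩ := hgood
  set γ : Node l := ⟨a, (Λ c).part a + 1, c⟩ with hγ
  obtain ⟨hkey, hres'⟩ := nodeKey_xiNode he0 hres
  obtain ⟨h1, h2⟩ := nodeKey_spec hres
  refine ⟨?_, hres', ?_⟩
  · have hlen : ∀ v, α < v → (μ (rho l c)).len v = (Λ c).len v := fun v hv => by
      rw [len_psi_of_lt hμ _ hv, prevComp, Equiv.symm_apply_apply]
    have hpart : ∀ r, 1 ≤ r → α < (Λ c).part r → (μ (rho l c)).part r = (Λ c).part r :=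
      fun r => part_eq_of_len_eq hlen
    refine ⟨ha, ?_, ?_⟩
    · dsimp only
      rw [hpart a ha hbig]
    · dsimp only
      rcases hadd.2.2 with h | h
      · exact Or.inl h
      · simp only [hγ] at h
        rcases Nat.eq_or_lt_of_le ha with h' | h'
        · exact Or.inl h'.symm
        · rw [hpart a ha hbig, hpart (a - 1) (by omega) (by omega)]
          exact Or.inr h
  · have hkey' : nodeKey e (xiCharge e s) i ⟨a, (Λ c).part a + 1, rho l c⟩ =
        nodeKey e s i γ + 1 := hkey
    rw [hkey']
    refine sum_letterAt_reduction (B := BeadAt e s Λ)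
      (T := fun z => α + edge e s Λ (α + 1) z) ?_ ?_ ?_ ?_ ?_ hleft hright
    · exact fun z z' h => add_le_add_right (edge_mono he0 hs hcyl (by omega) h) _
    · exact fun z => not_bead_edge _ _ _
    · intro z x hx hx'
      have h3 := hP.2.1.edge_succ_le he0 hs hcyl hα (z - 1)
      rw [sub_add_cancel] at h3
      have h4 := bead_of_edge (π := Λ (compAt l z)) (t := chargeAt e s z) (α := α) (x := x - α)
        (by simp only [edge] at h3 hx hx' ⊢; omega) (by simp only [edge] at hx'; omega)
      rwa [add_sub_cancel] at h4
    · exact beadAt_psi he0 hs hcyl hP hμ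
    · have h3 := ((Λ c).le_part_iff (v := α + 1) (by omega) ha).1 hbig
      simp only [edge, chargeAt, h1]
      simp only [content, hγ] at h2 ⊢
      push_cast at h2
      omega

end FockCrystal
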